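/- arXiv:2511.10039 — 6 statements merged into one kernel-verified Lean document; each statement's English description precedes it below -/
import Mathlib

section
/- Let N ≥ 2, let 1 ≤ m < N, let p ≥ 2 be a real number, let θ ∈ ℝ, let R > 0, and write points of ℝ^N = ℝ^m × ℝ^{N−m} as (ξ, η). Let Ω = {(ξ,η) : 0 < |ξ| < R} ⊆ ℝ^N. Then for every u ∈ C^∞_c(Ω;ℂ): ∫_Ω |∇_ξ u(ξ,η)·(ξ/|ξ|)|^p |ξ|^{−(m−p)} (log(R/|ξ|))^{θ+p} dξ dη ≥ |(θ+1)/p|^p ∫_Ω |u(ξ,η)|^p |ξ|^{−m} (log(R/|ξ|))^{θ} dξ dη. -/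
open MeasureTheory Real

noncomputable section

/-- Integration by parts against the Euler field in the first variables. -/
theorem hcl_euler {m k : ℕ}
    (w : EuclideanSpace ℝ (Fin m) × EuclideanSpace ℝ (Fin k) → ℝ)
    (hw : ContDiff ℝ 1 w) (hc : HasCompactSupport w) :
    Integrable (fun q => fderiv ℝ w q (q.1, 0)) ∧
    ∫ q, fderiv ℝ w q (q.1, 0) = - (m : ℝ) * ∫ q, w q := by
  have hw' : Continuous (fderiv ℝ w) := hw.continuous_fderiv one_ne_zero
  have hcw : Continuous w := hw.continuous
  let e : Fin m → EuclideanSpace ℝ (Fin m) × EuclideanSpace ℝ (Fin k) :=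
    fun i => (EuclideanSpace.single i 1, 0)
  let ℓ : Fin m → (EuclideanSpace ℝ (Fin m) × EuclideanSpace ℝ (Fin k)) →L[ℝ] ℝ :=
    fun i => (EuclideanSpace.proj i).comp (ContinuousLinearMap.fst ℝ _ _)
  have hint : ∀ i, Integrable (fun q => ℓ i q * fderiv ℝ w q (e i)) := by
    intro i
    refine Continuous.integrable_of_hasCompactSupport ?_ ?_
    · exact (ℓ i).continuous.mul (hw'.clm_apply continuous_const)
    · exact (hc.fderiv_apply ℝ (e i)).mul_left
  have hdec : ∀ q, fderiv ℝ w q (q.1, 0) = ∑ i, ℓ i q * fderiv ℝ w q (e i) := by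
    intro q
    have : (q.1, (0 : EuclideanSpace ℝ (Fin k))) = ∑ i, ℓ i q • e i := by
      refine Prod.ext ?_ ?_
      · rw [Prod.fst_sum]
        ext j
        simp [ℓ, e, Pi.single_apply]
      · rw [Prod.snd_sum]
        simp [e]
    rw [this, map_sum]
    simp
  have hfl : ∀ i q, fderiv ℝ (ℓ i) q (e i) = 1 := by
    intro i q
    rw [ContinuousLinearMap.fderiv]
    simp [ℓ, e]
  have hI : Integrable w := hcw.integrable_of_hasCompactSupport hc
  haveI : (volume : Measure (EuclideanSpace ℝ (Fin m) ×
      EuclideanSpace ℝ (Fin k))).IsAddHaarMeasure :=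
    inferInstanceAs (Measure.prod volume volume).IsAddHaarMeasure
  have hib : ∀ i, ∫ q, ℓ i q * fderiv ℝ w q (e i) = - ∫ q, w q := by
    intro i
    have := integral_mul_fderiv_eq_neg_fderiv_mul_of_integrable (μ := volume)
      (f := ℓ i) (g := w) (v := e i) (by simp only [hfl, one_mul]; exact hI) (hint i)
      (Continuous.integrable_of_hasCompactSupport ((ℓ i).continuous.mul hcw) hc.mul_left)
      (fun x _ => (ℓ i).differentiableAt)
      (fun x _ => hw.differentiable one_ne_zero x)
    rw [this]
    simp only [hfl, one_mul]
  simp_rw [hdec]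
  refine ⟨integrable_finsetSum _ fun i _ => hint i, ?_⟩
  rw [integral_finsetSum _ fun i _ => hint i]
  simp [hib]

/-- The pointwise Young inequality. -/
theorem hcl_young {p a b c : ℝ} (hp : 2 ≤ p) (ha : 0 ≤ a) (hb : 0 ≤ b) (hc : 0 ≤ c) :
    c ^ (p - 1) * (p * a ^ (p - 1) * b) ≤ (p - 1) * c ^ p * a ^ p + b ^ p := by
  have hpq : p.HolderConjugate (p / (p - 1)) := Real.HolderConjugate.conjExponent (by linarith)
  have h := young_inequality_of_nonneg hb (a := b) (b := (c * a) ^ (p - 1)) (by positivity) hpq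
  have hp1 : p - 1 ≠ 0 := by linarith
  rw [← Real.rpow_mul (by positivity), mul_div_cancel₀ _ hp1, Real.mul_rpow hc ha,
    Real.mul_rpow hc ha] at h
  have hp0 : p ≠ 0 := by linarith
  have h2 := mul_le_mul_of_nonneg_left h (by linarith : 0 ≤ p)
  have h3 : p * (b ^ p / p + c ^ p * a ^ p / (p / (p - 1))) =
      (p - 1) * c ^ p * a ^ p + b ^ p := by
    field_simp
    ring
  rw [h3] at h2
  linarith

theorem hcl_deriv {R : ℝ} (hR : 0 < R) (μ θ : ℝ) {r : ℝ} (h0 : 0 < r) (h1 : r < R) :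
    HasDerivAt (fun r : ℝ => r ^ (-μ) * Real.log (R / r) ^ (θ + 1))
      (-(μ * (r ^ (-μ) * Real.log (R / r) ^ (θ + 1)) + (θ + 1) * (r ^ (-μ) * Real.log (R / r) ^ θ)) / r) r := by
  have hL : 0 < Real.log (R / r) := Real.log_pos (by rw [lt_div_iff₀ h0]; linarith)
  have d1 : HasDerivAt (fun r : ℝ => r ^ (-μ)) (-μ * r ^ (-μ - 1)) r :=
    Real.hasDerivAt_rpow_const (Or.inl h0.ne')
  have d2 : HasDerivAt (fun r : ℝ => Real.log (R / r)) (-1 / r) r := by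
    have := (((hasDerivAt_id r).inv h0.ne').const_mul R).log (by simp; exact ⟨hR.ne', h0.ne'⟩)
    simp only [id, Pi.inv_apply, ← div_eq_mul_inv] at this
    convert this using 1
    field_simp
  have d3 := d2.rpow_const (p := θ + 1) (Or.inl hL.ne')
  have := d1.mul d3
  refine this.congr_deriv ?_
  rw [Real.rpow_sub_one h0.ne', add_sub_cancel_right]
  field_simp
  ring

/-- **Cylindrical logarithmic Hardy inequality in `ℝ^N = ℝ^m × ℝ^{N-m}`** on
`Ω = {0 < |ξ| < R}`.  Here `k = N - m ≥ 1`, so `1 ≤ m < N`. -/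
theorem hardy_cylindrical_logarithmic
    {m k : ℕ} (hm : 1 ≤ m) (hk : 1 ≤ k)
    {p : ℝ} (hp : 2 ≤ p) (θ : ℝ)
    {R : ℝ} (hR : 0 < R) :
    ∀ u : EuclideanSpace ℝ (Fin m) × EuclideanSpace ℝ (Fin k) → ℂ,
      ContDiff ℝ (⊤ : ℕ∞) u → HasCompactSupport u →
      tsupport u ⊆ {q : EuclideanSpace ℝ (Fin m) × EuclideanSpace ℝ (Fin k) |
        0 < ‖q.1‖ ∧ ‖q.1‖ < R} →
      |(θ + 1) / p| ^ p *
          ∫ q in {q : EuclideanSpace ℝ (Fin m) × EuclideanSpace ℝ (Fin k) |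
              0 < ‖q.1‖ ∧ ‖q.1‖ < R},
            ‖u q‖ ^ p * ‖q.1‖ ^ (-(m : ℝ)) * Real.log (R / ‖q.1‖) ^ θ
        ≤ ∫ q in {q : EuclideanSpace ℝ (Fin m) × EuclideanSpace ℝ (Fin k) |
              0 < ‖q.1‖ ∧ ‖q.1‖ < R},
            ‖fderiv ℝ u q (‖q.1‖⁻¹ • q.1, (0 : EuclideanSpace ℝ (Fin k)))‖ ^ p *
              ‖q.1‖ ^ (-((m : ℝ) - p)) * Real.log (R / ‖q.1‖) ^ (θ + p) := by
  intro u hu hcu hsu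
  set Ω := {q : EuclideanSpace ℝ (Fin m) × EuclideanSpace ℝ (Fin k) |
        0 < ‖q.1‖ ∧ ‖q.1‖ < R} with hΩ
  have hp0 : 0 < p := by linarith
  have hu1 : ContDiff ℝ 1 u := hu.of_le (by exact_mod_cast le_top)
  have hu' : Continuous (fderiv ℝ u) := hu1.continuous_fderiv one_ne_zero
  have hud : Differentiable ℝ u := hu1.differentiable one_ne_zero
  have huz : ∀ q, q ∉ tsupport u → u q = 0 := fun q hq => image_eq_zero_of_notMem_tsupport hq
  have hduz : ∀ q, q ∉ tsupport u → fderiv ℝ u q = 0 :=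
    fun q hq => fderiv_of_notMem_tsupport _ hq
  have hL : ∀ q ∈ Ω, 0 < Real.log (R / ‖q.1‖) := by
    rintro q ⟨h0, h1⟩
    exact Real.log_pos (by rw [lt_div_iff₀ h0]; linarith)
  -- the two integrands and the auxiliary function
  set A : EuclideanSpace ℝ (Fin m) × EuclideanSpace ℝ (Fin k) → ℝ := fun q =>
    ‖u q‖ ^ p * ‖q.1‖ ^ (-(m : ℝ)) * Real.log (R / ‖q.1‖) ^ θ with hA
  set B : EuclideanSpace ℝ (Fin m) × EuclideanSpace ℝ (Fin k) → ℝ := fun q =>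
    ‖fderiv ℝ u q (‖q.1‖⁻¹ • q.1, (0 : EuclideanSpace ℝ (Fin k)))‖ ^ p *
      ‖q.1‖ ^ (-((m : ℝ) - p)) * Real.log (R / ‖q.1‖) ^ (θ + p) with hB
  set φ : ℝ → ℝ := fun r => r ^ (-(m : ℝ)) * Real.log (R / r) ^ (θ + 1) with hφ
  set w : EuclideanSpace ℝ (Fin m) × EuclideanSpace ℝ (Fin k) → ℝ := fun q =>
    ‖u q‖ ^ p * φ ‖q.1‖ with hw
  have hAz : ∀ q, q ∉ tsupport u → A q = 0 := by
    intro q hq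
    simp [hA, huz q hq, hp0.ne']
  have hBz : ∀ q, q ∉ tsupport u → B q = 0 := by
    intro q hq
    simp [hB, hduz q hq, hp0.ne']
  have hwz : ∀ q, q ∉ tsupport u → w q = 0 := by
    intro q hq
    simp [hw, huz q hq, hp0.ne']
  have hts : ∀ f : EuclideanSpace ℝ (Fin m) × EuclideanSpace ℝ (Fin k) → ℝ,
      (∀ q, q ∉ tsupport u → f q = 0) → tsupport f ⊆ tsupport u := by
    intro f hf
    refine closure_minimal ?_ (isClosed_tsupport u)
    intro q hq
    by_contra h
    exact hq (hf q h)
  have hcs : ∀ f : EuclideanSpace ℝ (Fin m) × EuclideanSpace ℝ (Fin k) → ℝ,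
      (∀ q, q ∉ tsupport u → f q = 0) → HasCompactSupport f := fun f hf =>
    hcu.of_isClosed_subset (isClosed_tsupport f) (hts f hf)
  have hcn : ∀ q ∈ Ω, ContinuousAt (fun q : EuclideanSpace ℝ (Fin m) × EuclideanSpace ℝ (Fin k)
      => Real.log (R / ‖q.1‖)) q := by
    intro q hq
    refine ContinuousAt.log ?_ (div_pos hR hq.1).ne'
    exact continuousAt_const.div (by fun_prop) hq.1.ne'
  have hAc : Continuous A := by
    refine continuous_of_tsupport fun q hq => ?_
    have hq : q ∈ Ω := hsu (hts A hAz hq)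
    refine ContinuousAt.mul (ContinuousAt.mul ?_ ?_) ?_
    · exact hu1.continuous.norm.continuousAt.rpow_const (Or.inr hp0.le)
    · exact (by fun_prop : ContinuousAt (fun q : EuclideanSpace ℝ (Fin m) ×
        EuclideanSpace ℝ (Fin k) => ‖q.1‖) q).rpow_const (Or.inl hq.1.ne')
    · exact (hcn q hq).rpow_const (Or.inl (hL q hq).ne')
  have hBc : Continuous B := by
    refine continuous_of_tsupport fun q hq => ?_
    have hq : q ∈ Ω := hsu (hts B hBz hq)
    have hn : ContinuousAt (fun q : EuclideanSpace ℝ (Fin m) ×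
        EuclideanSpace ℝ (Fin k) => ‖q.1‖) q := by fun_prop
    refine ContinuousAt.mul (ContinuousAt.mul ?_ ?_) ?_
    · refine ContinuousAt.rpow_const (ContinuousAt.norm ?_) (Or.inr hp0.le)
      refine hu'.continuousAt.clm_apply (ContinuousAt.prodMk ?_ continuousAt_const)
      exact (hn.inv₀ hq.1.ne').smul continuousAt_fst
    · exact hn.rpow_const (Or.inl hq.1.ne')
    · exact (hcn q hq).rpow_const (Or.inl (hL q hq).ne')
  have hAi : Integrable A := hAc.integrable_of_hasCompactSupport (hcs A hAz)
  have hBi : Integrable B := hBc.integrable_of_hasCompactSupport (hcs B hBz)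
  have hup : ContDiff ℝ 1 (fun q => ‖u q‖ ^ p) := hu1.norm_rpow (by linarith)
  have hw1 : ContDiff ℝ 1 w := by
    refine contDiff_iff_contDiffAt.2 fun q => ?_
    by_cases hq : q ∈ tsupport u
    · have hq := hsu hq
      have hn : ContDiffAt ℝ 1 (fun q : EuclideanSpace ℝ (Fin m) ×
        EuclideanSpace ℝ (Fin k) => ‖q.1‖) q :=
        contDiffAt_fst.norm ℝ (norm_pos_iff.1 hq.1)
      refine hup.contDiffAt.mul (ContDiffAt.mul ?_ ?_)
      · exact hn.rpow_const_of_ne hq.1.ne'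
      · refine ContDiffAt.rpow_const_of_ne ?_ (hL q hq).ne'
        exact (contDiffAt_const.div hn hq.1.ne').log (div_pos hR hq.1).ne'
    · have : w =ᶠ[nhds q] fun _ => 0 := by
        filter_upwards [(isClosed_tsupport u).isOpen_compl.mem_nhds hq] with x hx
        exact hwz x hx
      exact contDiffAt_const.congr_of_eventuallyEq this
  have hwc : HasCompactSupport w := hcs w hwz
  have hwi : Integrable w := hw1.continuous.integrable_of_hasCompactSupport hwc
  obtain ⟨hDi, hDe⟩ := hcl_euler w hw1 hwc
  -- pointwise estimate
  set c := |(θ + 1) / p| with hc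
  have hc0 : 0 ≤ c := abs_nonneg _
  have hpt : ∀ q, c ^ (p - 1) * |fderiv ℝ w q (q.1, 0) + m * w q + (θ + 1) * A q| ≤
      (p - 1) * c ^ p * A q + B q := by
    intro q
    by_cases hq : q ∈ tsupport u
    · have hq := hsu hq
      have hLq := hL q hq
      obtain ⟨hr0, hr1⟩ := id hq
      have hnorm : HasFDerivAt (fun q : EuclideanSpace ℝ (Fin m) × EuclideanSpace ℝ (Fin k)
          => ‖q.1‖) ((fderiv ℝ (fun x : EuclideanSpace ℝ (Fin m) => ‖x‖) q.1).comp
            (ContinuousLinearMap.fst ℝ _ _)) q := by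
        have h1 : DifferentiableAt ℝ (fun x : EuclideanSpace ℝ (Fin m) => ‖x‖) q.1 :=
          differentiableAt_id.norm ℝ (norm_pos_iff.1 hr0)
        exact h1.hasFDerivAt.comp q hasFDerivAt_fst
      have hd1 : DifferentiableAt ℝ (fun x : EuclideanSpace ℝ (Fin m) => ‖x‖) q.1 :=
          differentiableAt_id.norm ℝ (norm_pos_iff.1 hr0)
      have hφd := (hcl_deriv hR (m : ℝ) θ hr0 hr1).comp_hasFDerivAt q hnorm
      have hud2 : HasFDerivAt (fun q => ‖u q‖ ^ p) _ q :=
        (hasFDerivAt_norm_rpow (u q) (by linarith : 1 < p)).comp q (hud q).hasFDerivAt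
      have hwd := hud2.mul hφd
      have hfw : fderiv ℝ w q = _ := hwd.fderiv
      have hlin : fderiv ℝ u q (q.1, 0) =
          ‖q.1‖ • fderiv ℝ u q (‖q.1‖⁻¹ • q.1, (0 : EuclideanSpace ℝ (Fin k))) := by
        rw [← map_smul]
        congr 1
        simp [smul_smul, mul_inv_cancel₀ hr0.ne']
      set v := fderiv ℝ u q (‖q.1‖⁻¹ • q.1, (0 : EuclideanSpace ℝ (Fin k))) with hv
      set r := ‖q.1‖ with hr
      set L := Real.log (R / r) with hLdef
      have hG : fderiv ℝ w q (q.1, 0) + m * w q + (θ + 1) * A q =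
          (p * ‖u q‖ ^ (p - 2) * inner ℝ (u q) v) * (r * L) * (r ^ (-(m : ℝ)) * L ^ θ) := by
        rw [hfw]
        simp only [add_apply, smul_apply,
          ContinuousLinearMap.comp_apply, ContinuousLinearMap.coe_fst', hd1.fderiv_norm_self,
          hlin, innerSL_apply_apply, smul_eq_mul, inner_smul_right, Function.comp]
        simp only [hw, hA, hφ, ← hr, ← hLdef]
        rw [Real.rpow_add_one hLq.ne']
        field_simp
        ring
      have hω : 0 ≤ r ^ (-(m : ℝ)) * L ^ θ := by positivity
      have hBq : B q = (‖v‖ * (r * L)) ^ p * (r ^ (-(m : ℝ)) * L ^ θ) := by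
        simp only [hB, ← hr, ← hLdef, ← hv]
        rw [Real.mul_rpow (by positivity) (by positivity), Real.mul_rpow hr0.le hLq.le,
          Real.rpow_add hLq, show -((m : ℝ) - p) = -(m : ℝ) + p by ring, Real.rpow_add hr0]
        ring
      have hAq : A q = ‖u q‖ ^ p * (r ^ (-(m : ℝ)) * L ^ θ) := by
        simp only [hA, ← hr, ← hLdef]
        ring
      have habs : |p * ‖u q‖ ^ (p - 2) * inner ℝ (u q) v| ≤ p * ‖u q‖ ^ (p - 1) * ‖v‖ := by
        rw [abs_mul, abs_of_nonneg (by positivity : 0 ≤ p * ‖u q‖ ^ (p - 2))]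
        have h1 := abs_real_inner_le_norm (u q) v
        have h2 : ‖u q‖ ^ (p - 1) = ‖u q‖ ^ (p - 2) * ‖u q‖ := by
          rw [← Real.rpow_add_one' (norm_nonneg _) (by linarith)]
          congr 1
          ring
        rw [h2]
        calc _ ≤ p * ‖u q‖ ^ (p - 2) * (‖u q‖ * ‖v‖) := by gcongr
          _ = _ := by ring
      have hy := hcl_young (b := ‖v‖ * (r * L)) hp (norm_nonneg (u q)) (by positivity) hc0
      rw [hG, hBq, hAq, abs_mul, abs_mul, abs_of_nonneg hω,
        abs_of_nonneg (by positivity : 0 ≤ r * L)]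
      calc _ ≤ c ^ (p - 1) * ((p * ‖u q‖ ^ (p - 1) * ‖v‖) * (r * L) *
            (r ^ (-(m : ℝ)) * L ^ θ)) := by gcongr
        _ = c ^ (p - 1) * (p * ‖u q‖ ^ (p - 1) * (‖v‖ * (r * L))) *
            (r ^ (-(m : ℝ)) * L ^ θ) := by ring
        _ ≤ ((p - 1) * c ^ p * ‖u q‖ ^ p + (‖v‖ * (r * L)) ^ p) *
            (r ^ (-(m : ℝ)) * L ^ θ) := by gcongr
        _ = _ := by ring
    · have hf : fderiv ℝ w q = 0 :=
        fderiv_of_notMem_tsupport _ (fun h => hq (hts w hwz h))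
      simp [hf, hAz q hq, hBz q hq, hwz q hq]
  -- conclusion
  have hsA : ∫ q in Ω, A q = ∫ q, A q :=
    setIntegral_eq_integral_of_forall_compl_eq_zero fun q hq => hAz q fun h => hq (hsu h)
  have hsB : ∫ q in Ω, B q = ∫ q, B q :=
    setIntegral_eq_integral_of_forall_compl_eq_zero fun q hq => hBz q fun h => hq (hsu h)
  rw [hsA, hsB]
  have hGi : Integrable (fun q => fderiv ℝ w q (q.1, 0) + m * w q + (θ + 1) * A q) :=
    (hDi.add (hwi.const_mul _)).add (hAi.const_mul _)
  have hGe : ∫ q, (fderiv ℝ w q (q.1, 0) + m * w q + (θ + 1) * A q) =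
      (θ + 1) * ∫ q, A q := by
    have hDw : Integrable (fun q => fderiv ℝ w q (q.1, 0) + m * w q) :=
      hDi.add (hwi.const_mul _)
    rw [integral_add hDw (hAi.const_mul _),
      integral_add hDi (hwi.const_mul _), integral_const_mul, integral_const_mul, hDe]
    ring
  have h1 := integral_mono (hGi.abs.const_mul (c ^ (p - 1)))
    ((hAi.const_mul ((p - 1) * c ^ p)).add hBi) hpt
  have h2 := abs_integral_le_integral_abs (μ := volume)
    (f := fun q => fderiv ℝ w q (q.1, 0) + m * w q + (θ + 1) * A q)
  rw [hGe, abs_mul] at h2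
  have h3 : ∫ q, ((p - 1) * c ^ p * A q + B q) = (p - 1) * c ^ p * (∫ q, A q) + ∫ q, B q := by
    rw [integral_add (hAi.const_mul _) hBi, integral_const_mul]
  simp only [Pi.add_apply] at h1
  rw [h3, integral_const_mul] at h1
  have h4 : |θ + 1| = p * c := by
    rw [hc, abs_div, abs_of_pos hp0]
    field_simp
  have h5 : c ^ p = c ^ (p - 1) * c := by
    rw [← Real.rpow_add_one' hc0 (by linarith)]
    congr 1
    ring
  have h6 : c ^ (p - 1) * (|θ + 1| * ∫ q, A q) ≤ _ :=
    (mul_le_mul_of_nonneg_left ((mul_le_mul_of_nonneg_left (le_abs_self _)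
      (abs_nonneg _)).trans h2) (Real.rpow_nonneg hc0 _)).trans h1
  rw [h4] at h6
  rw [h5] at h6 ⊢
  linarith
end
end

section
/- Let Ω = (−π/2, π/2) × ℝ ⊆ ℝ² and let θ ∈ ℝ. Then for every u ∈ C^∞_c(Ω;ℂ): ∫_Ω |−sin(x)·∂_x u(x,y) + cos(x)·∂_y u(x,y)|² (cos x)^{−2(θ−1)} e^{−2(θ−1)y} dx dy ≥ ((2θ−1)/2)² ∫_Ω |u(x,y)|² (cos x)^{−2θ} e^{−2(θ−1)y} dx dy. Moreover the constant ((2θ−1)/2)² is sharp: for every c > ((2θ−1)/2)² there exists u ∈ C^∞_c(Ω;ℂ) with ∫_Ω |u|² (cos x)^{−2θ} e^{−2(θ−1)y} dx dy > 0 and ∫_Ω |−sin(x)·∂_x u + cos(x)·∂_y u|² (cos x)^{−2(θ−1)} e^{−2(θ−1)y} dx dy < c ∫_Ω |u|² (cos x)^{−2θ} e^{−2(θ−1)y} dx dy. -/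
open MeasureTheory Real

noncomputable section

/-- The strip `Ω = (-π/2, π/2) × ℝ ⊆ ℝ²`. -/
def strip : Set (ℝ × ℝ) := Set.Ioo (-(Real.pi / 2)) (Real.pi / 2) ×ˢ (Set.univ : Set ℝ)

/-- The directional quantity `-sin(x) ∂_x u + cos(x) ∂_y u` at `q = (x,y)`. -/
def dirQ (u : ℝ × ℝ → ℂ) (q : ℝ × ℝ) : ℂ :=
  (-Real.sin q.1) • fderiv ℝ u q (1, 0) + (Real.cos q.1) • fderiv ℝ u q (0, 1)

open scoped ContDiff

/-- the coordinate map `ℝ² → strip`. -/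
def Psi (p : ℝ × ℝ) : ℝ × ℝ :=
  (arctan (p.1 * exp (-p.2)), p.2 - log (cos (arctan (p.1 * exp (-p.2)))))

def Phi (q : ℝ × ℝ) : ℝ × ℝ := (exp q.2 * sin q.1, q.2 + log (cos q.1))

lemma cos_Psi_pos (p : ℝ × ℝ) : 0 < cos (Psi p).1 := cos_arctan_pos _

lemma cos_Psi (p : ℝ × ℝ) : cos (Psi p).1 = exp (p.2 - (Psi p).2) := by
  have h := cos_Psi_pos p
  have : p.2 - (Psi p).2 = log (cos (Psi p).1) := by simp [Psi]
  rw [this, exp_log h]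

lemma sin_Psi (p : ℝ × ℝ) : sin (Psi p).1 = p.1 * exp (-(Psi p).2) := by
  have h := cos_Psi_pos p
  have h1 : tan (Psi p).1 = p.1 * exp (-p.2) := tan_arctan _
  rw [tan_eq_sin_div_cos, div_eq_iff h.ne', cos_Psi, mul_assoc, ← exp_add] at h1
  rw [h1]; congr 2; ring

lemma Psi_mem (p : ℝ × ℝ) : Psi p ∈ strip := by
  refine ⟨arctan_mem_Ioo _, trivial⟩

lemma Phi_Psi (p : ℝ × ℝ) : Phi (Psi p) = p := by
  ext
  · simp only [Phi]
    rw [sin_Psi, mul_left_comm, ← exp_add]; simp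
  · simp only [Phi]
    rw [cos_Psi, log_exp]; ring

lemma cos_pos_strip {q : ℝ × ℝ} (hq : q ∈ strip) : 0 < cos q.1 := cos_pos_of_mem_Ioo hq.1

lemma Psi_Phi {q : ℝ × ℝ} (hq : q ∈ strip) : Psi (Phi q) = q := by
  have hc := cos_pos_strip hq
  have h1 : arctan ((Phi q).1 * exp (-(Phi q).2)) = q.1 := by
    have : (Phi q).1 * exp (-(Phi q).2) = tan q.1 := by
      simp only [Phi]
      rw [neg_add, exp_add, exp_neg (log _), exp_log hc, exp_neg, tan_eq_sin_div_cos]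
      field_simp
    rw [this, arctan_tan hq.1.1 hq.1.2]
  ext
  · exact h1
  · simp only [Psi, h1]; simp [Phi]

lemma Psi_image : Psi '' Set.univ = strip := by
  ext q; constructor
  · rintro ⟨p, -, rfl⟩; exact Psi_mem p
  · intro hq; exact ⟨Phi q, trivial, Psi_Phi hq⟩

lemma Psi_contDiff : ContDiff ℝ ∞ Psi := by
  have h : ContDiff ℝ ∞ (fun p : ℝ × ℝ => arctan (p.1 * exp (-p.2))) :=
    contDiff_arctan.comp (by fun_prop)
  refine h.prodMk (contDiff_snd.sub ?_)
  exact (contDiff_cos.comp h).log (fun p => (cos_Psi_pos p).ne')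

def dPsi (p : ℝ × ℝ) : ℝ × ℝ →L[ℝ] ℝ × ℝ :=
  (Matrix.toLin (.finTwoProd ℝ) (.finTwoProd ℝ)
    !![cos (Psi p).1 ^ 2 * exp (-p.2), -(cos (Psi p).1 * sin (Psi p).1);
       sin (Psi p).1 * cos (Psi p).1 * exp (-p.2), cos (Psi p).1 ^ 2]).toContinuousLinearMap

lemma hasFDerivAt_Psi (p : ℝ × ℝ) : HasFDerivAt Psi (dPsi p) p := by
  unfold dPsi
  rw [Matrix.toLin_finTwoProd_toContinuousLinearMap]
  have hc := cos_Psi_pos p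
  have h0 : HasFDerivAt (fun p : ℝ × ℝ => p.1 * exp (-p.2)) _ p :=
    (hasFDerivAt_fst (𝕜 := ℝ) (p := p)).fun_mul
      (hasFDerivAt_snd (𝕜 := ℝ) (p := p)).fun_neg.exp
  have h1 := (hasDerivAt_arctan (p.1 * exp (-p.2))).comp_hasFDerivAt p h0
  have h2 := (((hasDerivAt_cos (Psi p).1).log hc.ne')).comp_hasFDerivAt p h1
  have h3 := h1.prodMk ((hasFDerivAt_snd (𝕜 := ℝ) (p := p)).sub h2)
  have hs : sin (Psi p).1 = cos (Psi p).1 * (p.1 * exp (-p.2)) := by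
    rw [sin_Psi, cos_Psi, mul_left_comm, ← exp_add]; congr 2; ring
  have hsq : (1 / (1 + (p.1 * exp (-p.2)) ^ 2)) = cos (Psi p).1 ^ 2 := by
    rw [← cos_sq_arctan]; rfl
  have hcs := sin_sq_add_cos_sq (Psi p).1
  refine HasFDerivAt.congr_fderiv (f := Psi) h3 ?_
  rw [hsq]
  symm
  ext
  · simp
  · simp; field_simp
  · simp; field_simp; linarith
  · simp; field_simp; linear_combination hcs - sin (Psi p).1 * hs

lemma det_dPsi (p : ℝ × ℝ) : (dPsi p).det = exp (p.2 - 2 * (Psi p).2) := by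
  unfold dPsi
  simp only [LinearMap.det_toContinuousLinearMap, LinearMap.det_toLin, Matrix.det_fin_two_of]
  have hcs := sin_sq_add_cos_sq (Psi p).1
  have : exp (p.2 - 2 * (Psi p).2) = cos (Psi p).1 ^ 2 * exp (-p.2) := by
    rw [cos_Psi, ← exp_nat_mul, ← exp_add]; congr 1; push_cast; ring
  rw [this]; linear_combination (cos (Psi p).1 ^ 2 * exp (-p.2)) * hcs

lemma change_var (g : ℝ × ℝ → ℝ) :
    ∫ q in strip, g q = ∫ p, exp (p.2 - 2 * (Psi p).2) * g (Psi p) := by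
  rw [← Psi_image, integral_image_eq_integral_abs_det_fderiv_smul volume MeasurableSet.univ
    (fun p _ => (hasFDerivAt_Psi p).hasFDerivWithinAt)
    (Function.LeftInverse.injective Phi_Psi).injOn]
  simp [det_dPsi]

/-- The function in straightened coordinates. -/
def hh (k : ℝ) (u : ℝ × ℝ → ℂ) (p : ℝ × ℝ) : ℂ := exp (-(k * p.2)) • u (Psi p)

lemma hh_fderiv (k : ℝ) (u : ℝ × ℝ → ℂ) (hu : Differentiable ℝ u) (p : ℝ × ℝ) :
    fderiv ℝ (hh k u) p (0, 1) + k • hh k u p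
      = (exp (-(k * p.2)) * cos (Psi p).1) • dirQ u (Psi p) := by
  have h1 : HasFDerivAt (fun p : ℝ × ℝ => u (Psi p)) _ p :=
    (hu (Psi p)).hasFDerivAt.comp p (hasFDerivAt_Psi p)
  have h2 : HasFDerivAt (fun p : ℝ × ℝ => exp (-(k * p.2))) _ p :=
    ((hasFDerivAt_snd (𝕜 := ℝ) (p := p)).const_mul k).fun_neg.exp
  have h3 : HasFDerivAt (hh k u) _ p := h2.smul h1
  rw [h3.fderiv]
  have hv : dPsi p (0, 1) = (-(cos (Psi p).1 * sin (Psi p).1)) • ((1, 0) : ℝ × ℝ)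
      + (cos (Psi p).1 ^ 2) • ((0, 1) : ℝ × ℝ) := by
    unfold dPsi
    rw [Matrix.toLin_finTwoProd_toContinuousLinearMap]
    simp
  simp only [add_apply, smul_apply,
    ContinuousLinearMap.comp_apply, hv, map_add, map_smul, ContinuousLinearMap.smulRight_apply,
    dirQ, hh]
  simp only [neg_apply, smul_apply,
    ContinuousLinearMap.coe_snd', smul_eq_mul]
  module

lemma intB (θ k : ℝ) (hk : k = (2 * θ - 1) / 2) (u : ℝ × ℝ → ℂ) :
    ∫ q in strip, ‖u q‖ ^ 2 * Real.cos q.1 ^ (-(2 * θ)) * Real.exp (-(2 * (θ - 1) * q.2))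
      = ∫ p, ‖hh k u p‖ ^ 2 := by
  rw [change_var]
  congr 1; ext p
  rw [hh, norm_smul, norm_of_nonneg (exp_pos _).le, cos_Psi, ← exp_mul, mul_pow, ← exp_nat_mul]
  have : exp (((2 : ℕ) : ℝ) * -(k * p.2)) = exp (p.2 - 2 * (Psi p).2) *
      exp ((p.2 - (Psi p).2) * -(2 * θ)) * exp (-(2 * (θ - 1) * (Psi p).2)) := by
    rw [← exp_add, ← exp_add, hk]; congr 1; push_cast; ring
  rw [this]; ring

lemma intA (θ k : ℝ) (hk : k = (2 * θ - 1) / 2) (u : ℝ × ℝ → ℂ) (hu : Differentiable ℝ u) :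
    ∫ q in strip, ‖dirQ u q‖ ^ 2 * Real.cos q.1 ^ (-(2 * (θ - 1))) *
            Real.exp (-(2 * (θ - 1) * q.2))
      = ∫ p, ‖fderiv ℝ (hh k u) p (0, 1) + k • hh k u p‖ ^ 2 := by
  rw [change_var]
  congr 1; ext p
  rw [hh_fderiv k u hu, norm_smul, cos_Psi, ← exp_add, norm_of_nonneg (exp_pos _).le, ← exp_mul,
    mul_pow, ← exp_nat_mul]
  have : exp (((2 : ℕ) : ℝ) * (-(k * p.2) + (p.2 - (Psi p).2))) = exp (p.2 - 2 * (Psi p).2) *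
      exp ((p.2 - (Psi p).2) * -(2 * (θ - 1))) * exp (-(2 * (θ - 1) * (Psi p).2)) := by
    rw [← exp_add, ← exp_add, hk]; congr 1; push_cast; ring
  rw [this]; ring

lemma flat_identity (k : ℝ) (h : ℝ × ℝ → ℂ) (hs : ContDiff ℝ ∞ h) (hc : HasCompactSupport h) :
    ∫ p, ‖fderiv ℝ h p (0, 1) + k • h p‖ ^ 2
      = (∫ p, ‖fderiv ℝ h p (0, 1)‖ ^ 2) + k ^ 2 * ∫ p, ‖h p‖ ^ 2 := by
  set D : ℝ × ℝ → ℂ := fun p => fderiv ℝ h p (0, 1) with hD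
  have hDc : Continuous D := (hs.continuous_fderiv (by simp)).clm_apply continuous_const
  have hDs : HasCompactSupport D := by
    refine hc.fderiv_apply (𝕜 := ℝ) _
  have hns : HasCompactSupport (fun p => ‖h p‖ ^ 2) := by
    refine hc.comp_left (g := fun z : ℂ => ‖z‖ ^ 2) (by simp)
  have hnD : HasCompactSupport (fun p => ‖D p‖ ^ 2) := by
    refine hDs.comp_left (g := fun z : ℂ => ‖z‖ ^ 2) (by simp)
  have hN : ContDiff ℝ ∞ (fun p => ‖h p‖ ^ 2) := hs.norm_sq ℝ
  have hNd : ∀ p, fderiv ℝ (fun p => ‖h p‖ ^ 2) p (0, 1) = 2 * inner ℝ (h p) (D p) := by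
    intro p
    have := ((hs.differentiable (by simp) p).hasFDerivAt.norm_sq).fderiv
    rw [this]; simp [hD]; ring
  have hz : ∫ p, fderiv ℝ (fun p => ‖h p‖ ^ 2) p (0, 1) = 0 := by
    have := integral_mul_fderiv_eq_neg_fderiv_mul_of_integrable (𝕜 := ℝ) (μ := volume)
      (f := fun _ : ℝ × ℝ => (1 : ℝ)) (g := fun p => ‖h p‖ ^ 2) (v := (0, 1)) (by simp)
      (by
        simp only [one_mul]
        exact ((hN.continuous_fderiv (by simp)).clm_apply
          continuous_const).integrable_of_hasCompactSupport (hns.fderiv_apply (𝕜 := ℝ) _))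
      (by
        simp only [one_mul]
        exact hN.continuous.integrable_of_hasCompactSupport hns)
      (by intros; fun_prop)
      (fun p _ => hN.differentiable (by simp) p)
    simpa using this
  have hI1 : Integrable (fun p => ‖D p‖ ^ 2) :=
    (hDc.norm.pow 2).integrable_of_hasCompactSupport hnD
  have hI2 : Integrable (fun p => ‖h p‖ ^ 2) :=
    hN.continuous.integrable_of_hasCompactSupport hns
  have hI3 : Integrable (fun p => fderiv ℝ (fun p => ‖h p‖ ^ 2) p (0, 1)) :=
    ((hN.continuous_fderiv (by simp)).clm_apply
          continuous_const).integrable_of_hasCompactSupport (hns.fderiv_apply (𝕜 := ℝ) _)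
  have key : ∀ p, ‖D p + k • h p‖ ^ 2 = ‖D p‖ ^ 2 + k ^ 2 * ‖h p‖ ^ 2
      + k * fderiv ℝ (fun p => ‖h p‖ ^ 2) p (0, 1) := by
    intro p
    rw [hNd, norm_add_sq_real, inner_smul_right, real_inner_comm, norm_smul, mul_pow, norm_eq_abs,
      sq_abs]
    ring
  change ∫ p, ‖D p + k • h p‖ ^ 2 = (∫ p, ‖D p‖ ^ 2) + _
  simp_rw [key]
  have hI4 : Integrable (fun p => ‖D p‖ ^ 2 + k ^ 2 * ‖h p‖ ^ 2) := hI1.add (hI2.const_mul _)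
  rw [integral_add hI4 (hI3.const_mul _),
    integral_add hI1 (hI2.const_mul _), integral_const_mul, integral_const_mul, hz]
  ring

lemma hh_contDiff (k : ℝ) (u : ℝ × ℝ → ℂ) (hu : ContDiff ℝ ∞ u) : ContDiff ℝ ∞ (hh k u) := by
  unfold hh
  have h1 : ContDiff ℝ ∞ (fun p : ℝ × ℝ => exp (-(k * p.2))) := by fun_prop
  exact h1.smul (hu.comp Psi_contDiff)

lemma Phi_contDiffAt {q : ℝ × ℝ} (hq : q ∈ strip) : ContDiffAt ℝ ∞ Phi q := by
  refine ContDiffAt.prodMk (by fun_prop) (contDiffAt_snd.add ?_)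
  exact ContDiffAt.log (by fun_prop) (cos_pos_strip hq).ne'

lemma hh_compact (k : ℝ) (u : ℝ × ℝ → ℂ) (hc : HasCompactSupport u) (hsub : tsupport u ⊆ strip) :
    HasCompactSupport (hh k u) := by
  have hK : IsCompact (Phi '' tsupport u) := by
    refine IsCompact.image_of_continuousOn hc ?_
    intro q hq
    exact (Phi_contDiffAt (hsub hq)).continuousAt.continuousWithinAt
  refine HasCompactSupport.intro hK ?_
  intro p hp
  have : Psi p ∉ tsupport u := fun h => hp ⟨Psi p, h, Phi_Psi p⟩
  simp [hh, image_eq_zero_of_notMem_tsupport this]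

lemma strip_open : IsOpen strip := isOpen_Ioo.prod isOpen_univ

open Classical in
/-- Pull back a function from flat coordinates. -/
def uu (k : ℝ) (h : ℝ × ℝ → ℂ) (q : ℝ × ℝ) : ℂ :=
  if q ∈ strip then exp (k * (Phi q).2) • h (Phi q) else 0

lemma hh_uu (k : ℝ) (h : ℝ × ℝ → ℂ) : hh k (uu k h) = h := by
  ext p
  rw [hh, uu, if_pos (Psi_mem p), Phi_Psi, smul_smul, ← exp_add]
  simp

lemma uu_zero (k : ℝ) (h : ℝ × ℝ → ℂ) {q : ℝ × ℝ} (hq : q ∉ Psi '' tsupport h) :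
    uu k h q = 0 := by
  by_cases hs : q ∈ strip
  · have : Phi q ∉ tsupport h := fun hm => hq ⟨Phi q, hm, Psi_Phi hs⟩
    simp [uu, image_eq_zero_of_notMem_tsupport this]
  · simp [uu, hs]

lemma uu_props (k : ℝ) (h : ℝ × ℝ → ℂ) (hs : ContDiff ℝ ∞ h) (hc : HasCompactSupport h) :
    ContDiff ℝ ∞ (uu k h) ∧ HasCompactSupport (uu k h) ∧ tsupport (uu k h) ⊆ strip := by
  have hK : IsCompact (Psi '' tsupport h) := IsCompact.image hc Psi_contDiff.continuous
  have hKs : Psi '' tsupport h ⊆ strip := by rintro _ ⟨p, -, rfl⟩; exact Psi_mem p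
  refine ⟨?_, HasCompactSupport.intro hK (fun q hq => uu_zero k h hq), ?_⟩
  · rw [contDiff_iff_contDiffAt]
    intro q
    by_cases hq : q ∈ strip
    · have h1 : ContDiffAt ℝ ∞ (fun q => exp (k * (Phi q).2) • h (Phi q)) q := by
        have hP := Phi_contDiffAt hq
        have h2 : ContDiffAt ℝ ∞ (fun q => exp (k * (Phi q).2)) q :=
          (contDiffAt_const.mul hP.snd).exp
        exact h2.smul (hs.contDiffAt.comp q hP)
      refine h1.congr_of_eventuallyEq ?_
      filter_upwards [strip_open.mem_nhds hq] with q' hq'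
      simp [uu, hq']
    · have h1 : ContDiffAt ℝ ∞ (fun _ : ℝ × ℝ => (0 : ℂ)) q := contDiffAt_const
      refine h1.congr_of_eventuallyEq ?_
      filter_upwards [hK.isClosed.isOpen_compl.mem_nhds (fun hm => hq (hKs hm))] with q' hq'
      exact uu_zero k h hq'
  · refine (closure_minimal ?_ hK.isClosed).trans hKs
    intro q hq
    by_contra hn
    exact hq (uu_zero k h hn)

lemma flat_example (ε : ℝ) (hε : 0 < ε) : ∃ h : ℝ × ℝ → ℂ, ContDiff ℝ ∞ h ∧ HasCompactSupport h ∧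
    0 < (∫ p, ‖h p‖ ^ 2) ∧ ∫ p, ‖fderiv ℝ h p (0, 1)‖ ^ 2 < ε * ∫ p, ‖h p‖ ^ 2 := by
  obtain ⟨b, hb, hbc, hb0⟩ : ∃ b : ℝ → ℝ, ContDiff ℝ ∞ b ∧ HasCompactSupport b ∧ b 0 = 1 := by
    obtain ⟨b⟩ : Nonempty (ContDiffBump (0 : ℝ)) := inferInstance
    exact ⟨b, b.contDiff, b.hasCompactSupport,
      b.one_of_mem_closedBall (Metric.mem_closedBall_self b.rIn_pos.le)⟩
  set M : ℝ := ∫ x, b x ^ 2 with hM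
  set N : ℝ := ∫ x, deriv b x ^ 2 with hN
  have hMpos : 0 < M := by
    refine Continuous.integral_pos_of_hasCompactSupport_nonneg_nonzero (x := 0)
      (hb.continuous.pow 2) (hbc.comp_left (g := fun z : ℝ => z ^ 2) (by simp))
      (fun x => sq_nonneg _) ?_
    simp [hb0]
  have hNnn : 0 ≤ N := integral_nonneg (fun x => sq_nonneg _)
  obtain ⟨R, hR1, hR2⟩ : ∃ R : ℝ, 1 ≤ R ∧ N < ε * M * R := by
    refine ⟨max 1 ((N + 1) / (ε * M)), le_max_left _ _, ?_⟩
    have h1 : (N + 1) / (ε * M) ≤ max 1 ((N + 1) / (ε * M)) := le_max_right _ _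
    rw [div_le_iff₀ (by positivity)] at h1
    linarith
  have hR0 : 0 < R := by linarith
  set g : ℝ × ℝ → ℝ := fun p => b p.1 * b (R⁻¹ * p.2) with hg
  have hgs : ContDiff ℝ ∞ g :=
    (hb.comp contDiff_fst).mul (hb.comp (contDiff_const.mul contDiff_snd))
  have hgc : HasCompactSupport g := by
    have hK : IsCompact (tsupport b ×ˢ ((fun t => R * t) '' tsupport b)) :=
      IsCompact.prod hbc (IsCompact.image hbc (by fun_prop))
    refine HasCompactSupport.intro hK ?_
    rintro ⟨s, t⟩ hp
    by_contra hne
    have h1 : b s ≠ 0 := left_ne_zero_of_mul hne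
    have h2 : b (R⁻¹ * t) ≠ 0 := right_ne_zero_of_mul hne
    exact hp ⟨subset_tsupport _ h1, R⁻¹ * t, subset_tsupport _ h2, by field_simp⟩
  have hd : ∀ p, fderiv ℝ (fun p => (g p : ℂ)) p (0, 1)
      = ((b p.1 * (R⁻¹ * deriv b (R⁻¹ * p.2)) : ℝ) : ℂ) := by
    intro p
    have hb1 : ∀ x, HasDerivAt b (deriv b x) x := fun x =>
      (hb.differentiable (by simp) x).hasDerivAt
    have h1 : HasFDerivAt (fun p : ℝ × ℝ => b p.1) _ p :=
      (hb1 p.1).comp_hasFDerivAt p (hasFDerivAt_fst (𝕜 := ℝ) (p := p))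
    have h2 : HasFDerivAt (fun p : ℝ × ℝ => b (R⁻¹ * p.2)) _ p :=
      (hb1 (R⁻¹ * p.2)).comp_hasFDerivAt p ((hasFDerivAt_snd (𝕜 := ℝ) (p := p)).const_mul R⁻¹)
    have h3 : HasFDerivAt (fun p => (g p : ℂ)) _ p :=
      Complex.ofRealCLM.hasFDerivAt.comp p (h1.mul h2)
    rw [h3.fderiv]
    simp
    left; ring
  have e1 : ∫ p, ‖(g p : ℂ)‖ ^ 2 = M * (R * M) := by
    have : ∀ p : ℝ × ℝ, ‖(g p : ℂ)‖ ^ 2 = b p.1 ^ 2 * b (R⁻¹ * p.2) ^ 2 := by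
      intro p; rw [Complex.norm_real, norm_eq_abs, sq_abs, hg]; ring
    simp_rw [this]
    rw [Measure.volume_eq_prod,
      integral_prod_mul (fun x => b x ^ 2) (fun x => b (R⁻¹ * x) ^ 2),
      Measure.integral_comp_mul_left (fun x => b x ^ 2) R⁻¹]
    simp [abs_of_pos hR0, hM]
  have e2 : ∫ p, ‖fderiv ℝ (fun p => (g p : ℂ)) p (0, 1)‖ ^ 2 = M * (R⁻¹ * N) := by
    have : ∀ p : ℝ × ℝ, ‖fderiv ℝ (fun p => (g p : ℂ)) p (0, 1)‖ ^ 2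
        = b p.1 ^ 2 * (R⁻¹ ^ 2 * deriv b (R⁻¹ * p.2) ^ 2) := by
      intro p; rw [hd, Complex.norm_real, norm_eq_abs, sq_abs]; ring
    simp_rw [this]
    rw [Measure.volume_eq_prod,
      integral_prod_mul (fun x => b x ^ 2) (fun x => R⁻¹ ^ 2 * deriv b (R⁻¹ * x) ^ 2),
      integral_const_mul,
      Measure.integral_comp_mul_left (fun x => deriv b x ^ 2) R⁻¹]
    rw [← hM, ← hN, inv_inv, abs_of_pos hR0, smul_eq_mul]
    field_simp
  refine ⟨fun p => (g p : ℂ), Complex.ofRealCLM.contDiff.comp hgs,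
    hgc.comp_left (g := fun x : ℝ => (x : ℂ)) (by simp), ?_, ?_⟩
  · rw [e1]; positivity
  · rw [e1, e2]
    have h4 : R⁻¹ * N < ε * (R * M) := by
      rw [inv_mul_lt_iff₀ hR0]
      have : ε * M * R * 1 ≤ ε * M * R * R := by gcongr
      linarith
    calc M * (R⁻¹ * N) < M * (ε * (R * M)) := by gcongr
      _ = _ := by ring

/-- **Hardy inequality in the strip `(-π/2,π/2) × ℝ` with sharp constant
`((2θ-1)/2)²`**, for the `2`-harmonic function `d = e^y cos x`. -/
theorem hardy_strip_sharp (θ : ℝ) :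
    (∀ u : ℝ × ℝ → ℂ,
      ContDiff ℝ (⊤ : ℕ∞) u → HasCompactSupport u → tsupport u ⊆ strip →
      ((2 * θ - 1) / 2) ^ 2 *
          ∫ q in strip, ‖u q‖ ^ 2 * Real.cos q.1 ^ (-(2 * θ)) *
            Real.exp (-(2 * (θ - 1) * q.2))
        ≤ ∫ q in strip, ‖dirQ u q‖ ^ 2 * Real.cos q.1 ^ (-(2 * (θ - 1))) *
            Real.exp (-(2 * (θ - 1) * q.2)))
    ∧
    (∀ c : ℝ, ((2 * θ - 1) / 2) ^ 2 < c →
      ∃ u : ℝ × ℝ → ℂ,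
        ContDiff ℝ (⊤ : ℕ∞) u ∧ HasCompactSupport u ∧ tsupport u ⊆ strip ∧
        0 < (∫ q in strip, ‖u q‖ ^ 2 * Real.cos q.1 ^ (-(2 * θ)) *
              Real.exp (-(2 * (θ - 1) * q.2))) ∧
        ∫ q in strip, ‖dirQ u q‖ ^ 2 * Real.cos q.1 ^ (-(2 * (θ - 1))) *
            Real.exp (-(2 * (θ - 1) * q.2))
          < c * ∫ q in strip, ‖u q‖ ^ 2 * Real.cos q.1 ^ (-(2 * θ)) *
              Real.exp (-(2 * (θ - 1) * q.2))) := by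
  refine ⟨?_, ?_⟩
  · intro u hu hc hsub
    rw [intB θ _ rfl u, intA θ _ rfl u (hu.differentiable (by simp)),
      flat_identity _ _ (hh_contDiff _ u hu) (hh_compact _ u hc hsub)]
    have : 0 ≤ ∫ p, ‖fderiv ℝ (hh ((2 * θ - 1) / 2) u) p (0, 1)‖ ^ 2 :=
      integral_nonneg (fun p => sq_nonneg _)
    linarith
  · intro c hcc
    obtain ⟨h, hs, hc, hpos, hlt⟩ := flat_example (c - ((2 * θ - 1) / 2) ^ 2) (by linarith)
    obtain ⟨p1, p2, p3⟩ := uu_props ((2 * θ - 1) / 2) h hs hc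
    refine ⟨uu ((2 * θ - 1) / 2) h, p1, p2, p3, ?_, ?_⟩
    · rw [intB θ _ rfl, hh_uu]; exact hpos
    · rw [intB θ _ rfl, intA θ _ rfl _ (p1.differentiable (by simp)), hh_uu,
        flat_identity _ _ hs hc]
      linarith
end
end

section
/- Let N ≥ 2, let θ ∈ ℝ, and let Ω = {x ∈ ℝ^N : x_1 < x_2 < ⋯ < x_N}. Then for every u ∈ C^∞_c(Ω;ℂ): ∫_Ω |∇u(x)|² |x|^{−2(θ−1)} dx ≥ [((N² − 2θ)/2)² + N(N−1)(θ−1)] ∫_Ω |u(x)|² |x|^{−2θ} dx. -/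
open MeasureTheory Real

noncomputable section

lemma hs_cont {N : ℕ} {K : Set (EuclideanSpace ℝ (Fin N))} (hK : IsCompact K)
    {g F : EuclideanSpace ℝ (Fin N) → ℝ} (hg : Continuous g) (h0 : ∀ x ∉ K, g x = 0)
    (hF : ∀ x ∈ K, ContinuousAt F x) : Integrable (fun x => g x * F x) := by
  refine Continuous.integrable_of_hasCompactSupport ?_ ?_
  · rw [continuous_iff_continuousAt]
    intro x
    by_cases hx : x ∈ K
    · exact hg.continuousAt.mul (hF x hx)
    · have : (fun x => g x * F x) =ᶠ[nhds x] fun _ => 0 := by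
        filter_upwards [hK.isClosed.isOpen_compl.mem_nhds hx] with y hy
        rw [h0 y hy, zero_mul]
      exact continuousAt_const.congr this.symm
  · exact HasCompactSupport.intro hK fun x hx => by rw [h0 x hx, zero_mul]

lemma hs_div {N : ℕ} {K : Set (EuclideanSpace ℝ (Fin N))} (hK : IsCompact K)
    {g F : EuclideanSpace ℝ (Fin N) → ℝ} (hg : ContDiff ℝ 1 g) (h0 : ∀ x ∉ K, g x = 0)
    (hF : ∀ x ∈ K, ContDiffAt ℝ 1 F x) (v : EuclideanSpace ℝ (Fin N)) :
    Integrable (fun x => fderiv ℝ (fun x => g x * F x) x v) ∧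
    ∫ x, fderiv ℝ (fun x => g x * F x) x v = 0 := by
  have hc : ContDiff ℝ 1 (fun x => g x * F x) := by
    rw [contDiff_iff_contDiffAt]
    intro x
    by_cases hx : x ∈ K
    · exact hg.contDiffAt.mul (hF x hx)
    · have : (fun x => g x * F x) =ᶠ[nhds x] fun _ => 0 := by
        filter_upwards [hK.isClosed.isOpen_compl.mem_nhds hx] with y hy
        rw [h0 y hy, zero_mul]
      exact contDiffAt_const.congr_of_eventuallyEq this
  have hs : HasCompactSupport (fun x => g x * F x) :=
    HasCompactSupport.intro hK fun x hx => by rw [h0 x hx, zero_mul]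
  have hi : Integrable (fun x => fderiv ℝ (fun x => g x * F x) x v) := by
    refine Continuous.integrable_of_hasCompactSupport ?_ ?_
    · exact (hc.continuous_fderiv one_ne_zero).clm_apply continuous_const
    · exact hs.fderiv_apply (𝕜 := ℝ) v
  refine ⟨hi, ?_⟩
  have := integral_mul_fderiv_eq_neg_fderiv_mul_of_integrable (μ := volume) (𝕜 := ℝ) (v := v)
    (f := fun x => g x * F x) (g := fun _ => (1:ℝ)) (by simpa using hi) (by simp)
    (by simpa using hc.continuous.integrable_of_hasCompactSupport hs)
    (fun x _ => hc.differentiable one_ne_zero x) (fun x _ => by fun_prop)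
  simpa using this.symm

lemma hs_alg1 {N : ℕ} (x : Fin N → ℝ) (hx : ∀ i j, i ≠ j → x i ≠ x j) :
    ∑ i, x i * ∑ j, (x i - x j)⁻¹ = (N:ℝ) * (N - 1) / 2 := by
  have h1 : ∑ i, x i * ∑ j, (x i - x j)⁻¹ = ∑ i, ∑ j, x i * (x i - x j)⁻¹ := by
    simp [Finset.mul_sum]
  have h2 : ∑ i, ∑ j, x i * (x i - x j)⁻¹ = ∑ i, ∑ j, x j * (x j - x i)⁻¹ := Finset.sum_comm
  have h3 : ∑ i, ∑ j, x i * (x i - x j)⁻¹ + ∑ i, ∑ j, x j * (x j - x i)⁻¹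
      = ∑ i : Fin N, ∑ j : Fin N, ((1:ℝ) - if i = j then 1 else 0) := by
    simp only [← Finset.sum_add_distrib]
    refine Finset.sum_congr rfl fun i _ => Finset.sum_congr rfl fun j _ => ?_
    by_cases h : i = j
    · simp [h]
    · have := sub_ne_zero.2 (hx i j h)
      have := sub_ne_zero.2 (hx i j h).symm
      simp only [h, if_false]
      field_simp
      ring
  simp only [Finset.sum_sub_distrib, Finset.sum_ite_eq, Finset.mem_univ, if_true] at h3
  simp at h3
  rw [h1]; linarith

lemma hs_alg2 {N : ℕ} (x : Fin N → ℝ) (hx : ∀ i j, i ≠ j → x i ≠ x j) :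
    ∑ i, (∑ j, (x i - x j)⁻¹) ^ 2 = ∑ i, ∑ j, ((x i - x j)⁻¹) ^ 2 := by
  let f : Fin N → Fin N → Fin N → ℝ := fun i j k =>
    (x i - x j)⁻¹ * (x i - x k)⁻¹ - if j = k then ((x i - x j)⁻¹)^2 else 0
  have hf : ∀ i j k, f i j k + f j k i + f k i j = 0 := by
    intro i j k
    simp only [f]
    by_cases h1 : i = j
    · subst h1; by_cases h2 : i = k
      · simp [h2]
      · simp [h2, Ne.symm h2, sq]
    by_cases h2 : i = k
    · subst h2; simp [h1, Ne.symm h1, sq]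
    by_cases h3 : j = k
    · subst h3; simp [h1, Ne.symm h1, sq]
    have := sub_ne_zero.2 (hx i j h1)
    have := sub_ne_zero.2 (hx i k h2)
    have := sub_ne_zero.2 (hx j k h3)
    have := sub_ne_zero.2 (hx i j h1).symm
    have := sub_ne_zero.2 (hx i k h2).symm
    have := sub_ne_zero.2 (hx j k h3).symm
    simp only [Ne.symm h2, h1, h3, if_false]
    field_simp
    ring
  have e1 : ∑ i, ∑ j, ∑ k, f j k i = ∑ i, ∑ j, ∑ k, f i j k := by
    rw [Finset.sum_comm]
    refine Finset.sum_congr rfl fun j _ => ?_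
    rw [Finset.sum_comm]
  have e2 : ∑ i, ∑ j, ∑ k, f k i j = ∑ i, ∑ j, ∑ k, f i j k := by
    refine (Finset.sum_congr rfl fun i _ => Finset.sum_comm).trans ?_
    rw [Finset.sum_comm]
  have e3 : ∑ i, ∑ j, ∑ k, (f i j k + f j k i + f k i j) = 0 := by simp [hf]
  simp only [Finset.sum_add_distrib, e1, e2] at e3
  have e4 : ∑ i, ∑ j, ∑ k, f i j k = 0 := by linarith
  simp only [f, Finset.sum_sub_distrib, Finset.sum_ite_eq, Finset.mem_univ, if_true] at e4
  rw [← sub_eq_zero, ← e4]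
  congr 1
  refine Finset.sum_congr rfl fun i _ => ?_
  rw [sq, Finset.sum_mul_sum]

def hsG {N : ℕ} (b : ℝ) (i : Fin N) (x : EuclideanSpace ℝ (Fin N)) : ℝ :=
  ∑ j, (x i - x j)⁻¹ + b * x i * (‖x‖ ^ 2)⁻¹

def hsF {N : ℕ} (s b : ℝ) (i : Fin N) (x : EuclideanSpace ℝ (Fin N)) : ℝ :=
  (‖x‖ ^ 2) ^ (-s) * hsG b i x

lemma hs_contDiff {N : ℕ} (s b : ℝ) (i : Fin N) (x : EuclideanSpace ℝ (Fin N))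
    (hx : ∀ i j, i ≠ j → x i ≠ x j) (h0 : x ≠ 0) : ContDiffAt ℝ 1 (hsF s b i) x := by
  have hq : ContDiffAt ℝ 1 (fun x : EuclideanSpace ℝ (Fin N) => ‖x‖ ^ 2) x :=
    (contDiff_norm_sq ℝ).contDiffAt
  have hq0 : ‖x‖ ^ 2 ≠ 0 := by simpa using h0
  have hp (j : Fin N) : ContDiffAt ℝ 1 (fun x : EuclideanSpace ℝ (Fin N) => x j) x := by
    fun_prop
  refine (hq.rpow_const_of_ne hq0).mul (ContDiffAt.add (ContDiffAt.sum fun j _ => ?_) ?_)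
  · by_cases h : i = j
    · subst h; simp only [sub_self]; exact contDiffAt_const
    · exact ((hp i).sub (hp j)).inv (sub_ne_zero.2 (hx i j h))
  · exact (contDiffAt_const.mul (hp i)).mul (hq.inv hq0)

lemma hs_deriv {N : ℕ} (s b : ℝ) (i : Fin N) (x : EuclideanSpace ℝ (Fin N))
    (hx : ∀ i j, i ≠ j → x i ≠ x j) (h0 : x ≠ 0) :
    fderiv ℝ (hsF s b i) x (EuclideanSpace.single i 1) =
      (‖x‖ ^ 2) ^ (-s) * (-(2 * s) * (x i * hsG b i x) / ‖x‖ ^ 2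
        - ∑ j, ((x i - x j)⁻¹) ^ 2 + b / ‖x‖ ^ 2 - 2 * b * (x i) ^ 2 / (‖x‖ ^ 2) ^ 2) := by
  set e : EuclideanSpace ℝ (Fin N) := EuclideanSpace.single i 1 with he
  have hq0 : ‖x‖ ^ 2 ≠ 0 := by simpa using h0
  have hd := (hs_contDiff s b i x hx h0).differentiableAt one_ne_zero
  rw [← hd.lineDeriv_eq_fderiv]
  have hl : HasDerivAt (fun t : ℝ => x + t • e) e 0 := by
    simpa using ((hasDerivAt_id (0:ℝ)).smul_const e).const_add x
  have hq : HasDerivAt (fun t : ℝ => ‖x + t • e‖ ^ 2) (2 * x i) 0 := by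
    have := hl.norm_sq
    simpa [he, EuclideanSpace.inner_single_right] using this
  have hi : HasDerivAt (F := ℝ) (fun t : ℝ => (x + t • e) i) 1 0 := by
    simpa [he] using (hasDerivAt_id (0:ℝ)).const_add (x i)
  have hj (j : Fin N) : HasDerivAt (F := ℝ) (fun t : ℝ => ((x + t • e) i - (x + t • e) j)⁻¹)
      (-((x i - x j)⁻¹) ^ 2) 0 := by
    by_cases h : i = j
    · subst h; simpa using hasDerivAt_const (0:ℝ) (0:ℝ)
    · have h1 : HasDerivAt (F := ℝ) (fun t : ℝ => (x + t • e) i - (x + t • e) j) 1 0 := by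
        have : HasDerivAt (F := ℝ) (fun t : ℝ => (x + t • e) j) 0 0 := by
          simpa [he, Ne.symm h] using hasDerivAt_const (0:ℝ) (x j)
        simpa using hi.fun_sub this
      have h2 := h1.fun_inv (by simpa using sub_ne_zero.2 (hx i j h))
      refine h2.congr_deriv ?_
      rw [zero_smul, add_zero, inv_pow, neg_div, one_div]
  have hG := (HasDerivAt.fun_sum (u := Finset.univ) fun j _ => hj j).add
    ((hi.const_mul b).mul (hq.fun_inv (by simpa using h0)))
  have hF := (hq.rpow_const (p := -s) (Or.inl (by simpa using h0))).mul hG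
  have : lineDeriv ℝ (hsF s b i) x e = _ := hF.deriv
  rw [this]
  have hr : (‖x‖ ^ 2) ^ (-s - 1) = (‖x‖ ^ 2) ^ (-s) / ‖x‖ ^ 2 :=
    Real.rpow_sub_one hq0 _
  simp only [zero_smul, add_zero, hr, hsG, Pi.add_apply, Pi.mul_apply]
  simp only [Finset.sum_neg_distrib]
  field_simp
  ring

lemma hs_key {N : ℕ} (s b : ℝ) (x : EuclideanSpace ℝ (Fin N))
    (hx : ∀ i j, i ≠ j → x i ≠ x j) (h0 : x ≠ 0) (a : ℂ) (v : Fin N → ℂ) :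
    (s * (N * (N - 1)) - b * (N * (N - 1) + b - 2 * s - 2 + N)) *
       (‖a‖ ^ 2 * ((‖x‖ ^ 2) ^ (-s) / ‖x‖ ^ 2)) + 
     ∑ i, (2 * inner ℝ a (v i) * hsF s b i x + ‖a‖ ^ 2 *
       fderiv ℝ (hsF s b i) x (EuclideanSpace.single i 1)) ≤
     (∑ i, ‖v i‖ ^ 2) * (‖x‖ ^ 2) ^ (-s) := by
  have hq0 : ‖x‖ ^ 2 ≠ 0 := by simpa using h0
  have hW : 0 ≤ (‖x‖ ^ 2) ^ (-s) := by positivity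
  have hxx : ∑ i, x i ^ 2 = ‖x‖ ^ 2 := by rw [EuclideanSpace.real_norm_sq_eq]
  have A1 := hs_alg1 (fun i => x i) hx
  have A2 := hs_alg2 (fun i => x i) hx
  have B1 : ∑ i, x i * hsG b i x = (N:ℝ) * (N - 1) / 2 + b := by
    have : ∀ i, x i * hsG b i x = x i * ∑ j, (x i - x j)⁻¹ + b * (‖x‖ ^ 2)⁻¹ * x i ^ 2 := by
      intro i; simp only [hsG]; ring
    simp only [this, Finset.sum_add_distrib, A1, ← Finset.mul_sum, hxx]
    field_simp
  have B2 : ∑ i, (hsG b i x) ^ 2 = ∑ i, ∑ j, ((x i - x j)⁻¹) ^ 2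
      + (b * (N * (N - 1)) + b ^ 2) / ‖x‖ ^ 2 := by
    have : ∀ i, (hsG b i x) ^ 2 = (∑ j, (x i - x j)⁻¹) ^ 2
        + 2 * b * (‖x‖ ^ 2)⁻¹ * (x i * ∑ j, (x i - x j)⁻¹)
        + b ^ 2 * ((‖x‖ ^ 2)⁻¹) ^ 2 * x i ^ 2 := by
      intro i; simp only [hsG]; ring
    simp only [this, Finset.sum_add_distrib, A1, A2, ← Finset.mul_sum, hxx]
    field_simp
    ring
  have B3 : ∑ i, fderiv ℝ (hsF s b i) x (EuclideanSpace.single i 1) =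
      (‖x‖ ^ 2) ^ (-s) * ((-(2 * s) * ((N:ℝ) * (N - 1) / 2 + b) + b * N - 2 * b) / ‖x‖ ^ 2
       - ∑ i, ∑ j, ((x i - x j)⁻¹) ^ 2) := by
    simp only [hs_deriv s b _ x hx h0, ← Finset.mul_sum, Finset.sum_add_distrib,
      Finset.sum_sub_distrib, ← Finset.sum_div, B1, hxx]
    simp only [Finset.sum_const, Finset.card_univ, Fintype.card_fin, nsmul_eq_mul]
    field_simp
    ring
  have hp : ∀ i, 2 * inner ℝ a (v i) * hsG b i x - ‖a‖ ^ 2 * hsG b i x ^ 2 ≤ ‖v i‖ ^ 2 := by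
    intro i
    have := norm_sub_sq_real (v i) (hsG b i x • a)
    rw [norm_smul, inner_smul_right, mul_pow, Real.norm_eq_abs, sq_abs, real_inner_comm] at this
    nlinarith [sq_nonneg ‖v i - hsG b i x • a‖]
  have hs := mul_le_mul_of_nonneg_right (Finset.sum_le_sum fun i (_ : i ∈ Finset.univ) => hp i) hW
  refine le_trans (le_of_eq ?_) hs
  rw [Finset.sum_add_distrib, ← Finset.mul_sum, B3, Finset.sum_sub_distrib, ← Finset.mul_sum, B2]
  have : ∑ i, 2 * inner ℝ a (v i) * hsF s b i x
      = (∑ i, 2 * inner ℝ a (v i) * hsG b i x) * (‖x‖ ^ 2) ^ (-s) := by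
    rw [Finset.sum_mul]; refine Finset.sum_congr rfl fun i _ => ?_
    simp only [hsF]; ring
  rw [this]
  field_simp
  ring

theorem hardy_special_domain
    {N : ℕ} (hN : 2 ≤ N) (θ : ℝ) :
    ∀ u : EuclideanSpace ℝ (Fin N) → ℂ,
      ContDiff ℝ (⊤ : ℕ∞) u → HasCompactSupport u →
      tsupport u ⊆ {x : EuclideanSpace ℝ (Fin N) | ∀ i j : Fin N, i < j → x i < x j} →
      ((((N : ℝ) ^ 2 - 2 * θ) / 2) ^ 2 + (N : ℝ) * ((N : ℝ) - 1) * (θ - 1)) *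
          ∫ x in {x : EuclideanSpace ℝ (Fin N) | ∀ i j : Fin N, i < j → x i < x j},
            ‖u x‖ ^ 2 * ‖x‖ ^ (-(2 * θ))
        ≤ ∫ x in {x : EuclideanSpace ℝ (Fin N) | ∀ i j : Fin N, i < j → x i < x j},
            (∑ i, ‖fderiv ℝ u x (EuclideanSpace.single i 1)‖ ^ 2) *
              ‖x‖ ^ (-(2 * (θ - 1))) := by
  intro u hu hc hsub
  have hu1 : ContDiff ℝ 1 u := hu.of_le (by exact_mod_cast le_top)
  have hne : ∀ x ∈ tsupport u, ∀ i j : Fin N, i ≠ j → x i ≠ x j := by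
    intro x hx i j hij
    rcases lt_or_gt_of_ne hij with h | h
    · exact (hsub hx i j h).ne
    · exact (hsub hx j i h).ne'
  have hx0 : ∀ x ∈ tsupport u, x ≠ 0 := by
    rintro x hx rfl
    have := hne 0 hx ⟨0, by omega⟩ ⟨1, by omega⟩ (by simp)
    simp at this
  have hu0 : ∀ x ∉ tsupport u, u x = 0 := fun x hx => image_eq_zero_of_notMem_tsupport hx
  have hdu0 : ∀ x ∉ tsupport u, fderiv ℝ u x = 0 := fun x hx =>
    image_eq_zero_of_notMem_tsupport fun h => hx (tsupport_fderiv_subset ℝ h)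
  rw [setIntegral_eq_integral_of_forall_compl_eq_zero, 
    setIntegral_eq_integral_of_forall_compl_eq_zero]
  rotate_left
  · intro x hx
    simp [hdu0 x (fun h => hx (hsub h))]
  · intro x hx
    simp [hu0 x (fun h => hx (hsub h))]
  set s := θ - 1 with hs
  set b : ℝ := -(((N : ℝ) ^ 2 - 2 * θ) / 2) with hb
  have hg : ContDiff ℝ 1 (fun x => ‖u x‖ ^ 2) := hu1.norm_sq ℝ
  have hg0 : ∀ x ∉ tsupport u, ‖u x‖ ^ 2 = 0 := fun x hx => by simp [hu0 x hx]
  have hrp (p : ℝ) : ∀ x ∈ tsupport u, ContinuousAt (fun x => ‖x‖ ^ p) x := fun x hx =>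
    continuousAt_id.norm.rpow_const (Or.inl (by simpa using hx0 x hx))
  have I1 : Integrable (fun x => ‖u x‖ ^ 2 * ‖x‖ ^ (-(2 * θ))) :=
    hs_cont hc hg.continuous hg0 (hrp _)
  have I2 : Integrable (fun x => (∑ i, ‖fderiv ℝ u x (EuclideanSpace.single i 1)‖ ^ 2) *
              ‖x‖ ^ (-(2 * s))) := by
    refine hs_cont hc ?_ (fun x hx => by simp [hdu0 x hx]) (hrp _)
    have := hu1.continuous_fderiv one_ne_zero
    fun_prop
  have D := fun i : Fin N => hs_div (F := hsF s b i) hc hg hg0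
    (fun x hx => hs_contDiff s b i x (hne x hx) (hx0 x hx)) (EuclideanSpace.single i 1)
  have I3 := integrable_finsetSum Finset.univ fun i _ => (D i).1
  have J3 := integral_finsetSum Finset.univ fun i _ => (D i).1
  simp only [fun i => (D i).2, Finset.sum_const_zero] at J3
  rw [← integral_const_mul, ← add_zero (∫ x, _ * _), ← J3, ← integral_add (I1.const_mul _) I3]
  refine integral_mono ((I1.const_mul _).add I3) I2 fun x => ?_
  by_cases hx : x ∈ tsupport u
  · have key := hs_key s b x (hne x hx) (hx0 x hx) (u x) 
      (fun i => fderiv ℝ u x (EuclideanSpace.single i 1))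
    have e1 : (‖x‖ ^ 2) ^ (-s) = ‖x‖ ^ (-(2 * s)) := by
      rw [← Real.rpow_natCast, ← Real.rpow_mul (norm_nonneg x)]; congr 1; push_cast; ring
    have e2 : (‖x‖ ^ 2) ^ (-s) / ‖x‖ ^ 2 = ‖x‖ ^ (-(2 * θ)) := by
      rw [e1, ← Real.rpow_natCast, ← Real.rpow_sub (by simpa using hx0 x hx)]
      congr 1; rw [hs]; push_cast; ring
    rw [e2, e1] at key
    refine le_trans (le_of_eq ?_) key
    congr 1
    · congr 1
      rw [hb, hs]; ring
    · refine Finset.sum_congr rfl fun i _ => ?_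
      have d1 := (hu1.differentiable one_ne_zero x)
      have d2 := (hs_contDiff s b i x (hne x hx) (hx0 x hx)).differentiableAt one_ne_zero
      have d3 := d1.hasFDerivAt.norm_sq.mul d2.hasFDerivAt
      rw [show (fun x => ‖u x‖ ^ 2 * hsF s b i x) = _ from rfl]
      erw [d3.fderiv]
      simp
      ring
  · have : ∀ i, fderiv ℝ (fun x => ‖u x‖ ^ 2 * hsF s b i x) x = 0 := by
      intro i
      refine image_eq_zero_of_notMem_tsupport fun h => hx ?_
      refine closure_minimal ?_ (isClosed_tsupport u) (tsupport_fderiv_subset ℝ h)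
      intro y hy
      by_contra h'
      exact hy (by simp [hu0 y h'])
    simp [this, hu0 x hx, hdu0 x hx]
end
end

section
/- Let N ≥ 2 and let θ ∈ ℝ with N² > 2θ. Then for every real-valued u ∈ C^∞_c(ℝ^N) that is antisymmetric, i.e. for every transposition of two coordinates i ≠ j one has u(x_1,…,x_i,…,x_j,…,x_N) = −u(x_1,…,x_j,…,x_i,…,x_N) (equivalently, u(x∘τ) = sign(τ)·u(x) for every permutation τ of the coordinates), the following inequality holds: ∫_{ℝ^N} |∇u(x)|² |x|^{−2(θ−1)} dx ≥ [((N² − 2θ)/2)² + N(N−1)(θ−1)] ∫_{ℝ^N} |u(x)|² |x|^{−2θ} dx. -/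
open MeasureTheory Real

noncomputable section

open Filter Topology

/-- Euclidean space. -/
abbrev EE (N : ℕ) := EuclideanSpace ℝ (Fin N)

/-- Partial derivative. -/
def pd {N : ℕ} (i : Fin N) (u : EE N → ℝ) : EE N → ℝ :=
  fun x => fderiv ℝ u x (EuclideanSpace.single i 1)

/-- Iterated partial derivatives. -/
def DD {N : ℕ} : List (Fin N) → (EE N → ℝ) → (EE N → ℝ)
  | [], u => u
  | (i :: l), u => DD l (pd i u)

lemma pd_smooth {N : ℕ} {u : EE N → ℝ} (hu : ContDiff ℝ (⊤ : ℕ∞) u) (i : Fin N) :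
    ContDiff ℝ (⊤ : ℕ∞) (pd i u) := by
  unfold pd
  exact (hu.fderiv_right (m := (⊤ : ℕ∞)) (by simp)).clm_apply contDiff_const

lemma pd_comm {N : ℕ} {u : EE N → ℝ} (hu : ContDiff ℝ (⊤ : ℕ∞) u) (i j : Fin N) :
    pd i (pd j u) = pd j (pd i u) := by
  have hd : Differentiable ℝ (fderiv ℝ u) :=
    (hu.fderiv_right (m := (⊤ : ℕ∞)) (by simp)).differentiable (by simp)
  funext x
  have key : ∀ v w : EE N, fderiv ℝ (fun y => fderiv ℝ u y v) x w = fderiv ℝ (fderiv ℝ u) x w v := by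
    intro v w
    rw [fderiv_clm_apply (hd x) (by fun_prop)]
    simp
  have hs : IsSymmSndFDerivAt ℝ u x := by
    apply ContDiffAt.isSymmSndFDerivAt (n := (⊤ : ℕ∞)) hu.contDiffAt
    simp only [minSmoothness_of_isRCLikeNormedField]
    exact WithTop.coe_le_coe.mpr (le_top : (2 : ℕ∞) ≤ ⊤)
  unfold pd
  rw [key, key]
  exact hs _ _

lemma DD_perm {N : ℕ} {l l' : List (Fin N)} (h : l.Perm l') :
    ∀ u : EE N → ℝ, ContDiff ℝ (⊤ : ℕ∞) u → DD l u = DD l' u := by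
  induction h with
  | nil => intros; rfl
  | cons a _ ih => intro u hu; exact ih _ (pd_smooth hu a)
  | swap a b l => intro u hu; simp only [DD]; rw [pd_comm hu]
  | trans _ _ h1 h2 => intro u hu; rw [h1 u hu, h2 u hu]

/-- coordinate swap -/
def SS {N : ℕ} (i j : Fin N) : EE N ≃ₗᵢ[ℝ] EE N :=
  LinearIsometryEquiv.piLpCongrLeft 2 ℝ ℝ (Equiv.swap i j)

lemma SS_apply {N : ℕ} (i j : Fin N) (x : EE N) (k : Fin N) :
    SS i j x k = x (Equiv.swap i j k) := by
  simp [SS, LinearIsometryEquiv.piLpCongrLeft_apply]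

lemma SS_eq {N : ℕ} (i j : Fin N) (x : EE N) :
    (WithLp.equiv 2 (Fin N → ℝ)).symm (fun k => x (Equiv.swap i j k)) = SS i j x := by
  ext k
  rw [SS_apply]; rfl

lemma DD_swap {N : ℕ} (i j : Fin N) (l : List (Fin N)) :
    ∀ f g : EE N → ℝ, ContDiff ℝ (⊤ : ℕ∞) f → ContDiff ℝ (⊤ : ℕ∞) g →
      (∀ x, f (SS i j x) = - g x) →
      ∀ x, DD (l.map (Equiv.swap i j)) f (SS i j x) = - DD l g x := by
  induction l with
  | nil => intro f g _ _ h x; exact h x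
  | cons a l ih =>
    intro f g hf hg h x
    simp only [List.map_cons, DD]
    apply ih _ _ (pd_smooth hf _) (pd_smooth hg _)
    intro y
    have h1 : (fun x => f (SS i j x)) = fun x => - g x := funext h
    have h2 : fderiv ℝ (fun x => f (SS i j x)) y (EuclideanSpace.single a 1)
        = - fderiv ℝ g y (EuclideanSpace.single a 1) := by
      rw [h1, fderiv_fun_neg]; simp
    have h3 : HasFDerivAt (fun x => f (SS i j x))
        ((fderiv ℝ f (SS i j y)).comp
          ((SS i j).toContinuousLinearEquiv : EE N →L[ℝ] EE N)) y :=
      ((hf.differentiable (by simp)) _).hasFDerivAt.comp y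
        ((SS i j).toContinuousLinearEquiv : EE N →L[ℝ] EE N).hasFDerivAt
    rw [h3.fderiv] at h2
    have h4 : SS i j (EuclideanSpace.single a (1 : ℝ)) = EuclideanSpace.single (Equiv.swap i j a) 1 := by
      ext k
      rw [SS_apply]
      simp only [PiLp.single_apply]
      congr 1
      rw [eq_iff_iff]
      constructor
      · intro h; rw [← h]; simp
      · intro h; rw [h]; simp
    unfold pd
    rw [← h2, ← h4]
    rfl

lemma exists_count_eq {N : ℕ} (l : List (Fin N)) (hl : l.length < N * (N - 1) / 2) :
    ∃ i j : Fin N, i ≠ j ∧ l.count i = l.count j := by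
  by_contra! hc
  have hinj : Function.Injective (fun i : Fin N => ((l.count i : ℕ) : ℤ)) := by
    intro i j hij
    by_contra hne
    have hij : ((l.count i : ℕ) : ℤ) = ((l.count j : ℕ) : ℤ) := hij
    exact hc i j hne (by exact_mod_cast hij)
  have h1 := Finset.sum_range_le_sum (s := Finset.univ.image (fun i : Fin N => ((l.count i : ℕ) : ℤ)))
    (c := 0) (by intro x hx; simp at hx; obtain ⟨a, rfl⟩ := hx; positivity)
  rw [Finset.card_image_of_injective _ hinj, Finset.sum_image (fun a _ b _ h => hinj h)] at h1
  have h2 : ∑ i : Fin N, l.count i = l.length := by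
    have := Multiset.sum_count_eq_card (s := Finset.univ) (m := (l : Multiset (Fin N))) (by simp)
    simpa using this
  have h3 : ((∑ i ∈ Finset.range N, i : ℕ) : ℤ) ≤ ((∑ i : Fin N, l.count i : ℕ) : ℤ) := by
    push_cast
    simpa using h1
  rw [h2, Finset.sum_range_id] at h3
  have : N * (N - 1) / 2 ≤ l.length := by exact_mod_cast h3
  omega

lemma DD_zero {N : ℕ} {u : EE N → ℝ} (hu : ContDiff ℝ (⊤ : ℕ∞) u)
    (ha : ∀ i j : Fin N, i ≠ j → ∀ x, u (SS i j x) = - u x) (l : List (Fin N))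
    (hl : l.length < N * (N - 1) / 2) : DD l u 0 = 0 := by
  obtain ⟨i, j, hij, hc⟩ := exists_count_eq l hl
  have h1 := DD_swap i j l u u hu hu (ha i j hij) 0
  have hp : (l.map (Equiv.swap i j)).Perm l := by
    rw [List.perm_iff_count]
    intro a
    have : (l.map (Equiv.swap i j)).count a = l.count (Equiv.swap i j a) := by
      have := List.count_map_of_injective l (Equiv.swap i j) (Equiv.swap i j).injective
        (Equiv.swap i j a)
      simpa using this
    rw [this]
    by_cases h : a = i
    · subst h; simp [hc]
    · by_cases haj : a = j
      · subst haj; simp [hc]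
      · rw [Equiv.swap_apply_of_ne_of_ne h haj]
  rw [DD_perm hp u hu] at h1
  simp at h1
  linarith

lemma fderiv_apply_eq {N : ℕ} (u : EE N → ℝ) (x v : EE N) :
    fderiv ℝ u x v = ∑ i, v i * pd i u x := by
  conv_lhs => rw [← (EuclideanSpace.basisFun (Fin N) ℝ).sum_repr v]
  rw [map_sum]
  simp [pd]

lemma norm_fderiv_le {N : ℕ} (u : EE N → ℝ) (x : EE N) :
    ‖fderiv ℝ u x‖ ≤ ∑ i, |pd i u x| := by
  apply ContinuousLinearMap.opNorm_le_bound _ (by positivity)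
  intro v
  rw [fderiv_apply_eq, Finset.sum_mul]
  refine (norm_sum_le _ _).trans (Finset.sum_le_sum fun i _ => ?_)
  rw [norm_mul, mul_comm]
  gcongr
  · exact le_rfl
  · exact PiLp.norm_apply_le v i

lemma vanish_bound {N : ℕ} (n : ℕ) : ∀ f : EE N → ℝ, ContDiff ℝ (⊤ : ℕ∞) f →
    (∀ l : List (Fin N), l.length < n → DD l f 0 = 0) →
    ∃ C, 0 ≤ C ∧ ∀ x : EE N, ‖x‖ ≤ 1 → |f x| ≤ C * ‖x‖ ^ n := by
  induction n with
  | zero =>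
    intro f hf _
    obtain ⟨C, hC⟩ := (isCompact_closedBall (0 : EE N) 1).exists_bound_of_continuousOn
      hf.continuous.continuousOn
    refine ⟨|C|, abs_nonneg _, fun x hx => ?_⟩
    have := hC x (by simpa using hx)
    rw [Real.norm_eq_abs] at this
    simpa using this.trans (le_abs_self C)
  | succ n ih =>
    intro f hf h
    have h1 : ∀ i : Fin N, ∃ C, 0 ≤ C ∧ ∀ x : EE N, ‖x‖ ≤ 1 → |pd i f x| ≤ C * ‖x‖ ^ n := by
      intro i
      apply ih _ (pd_smooth hf i)
      intro l hl
      exact h (i :: l) (by simpa using hl)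
    choose C hC0 hC using h1
    refine ⟨∑ i, C i, Finset.sum_nonneg fun i _ => hC0 i, fun x hx => ?_⟩
    have hf0 : f 0 = 0 := h [] (by simp)
    have := (convex_closedBall (0 : EE N) ‖x‖).norm_image_sub_le_of_norm_fderiv_le (𝕜 := ℝ) (f := f)
      (C := (∑ i, C i) * ‖x‖ ^ n) (x := 0) (y := x)
      (fun y _ => (hf.differentiable (by simp)) y) (fun y hy => by
        have hy : ‖y‖ ≤ ‖x‖ := by simpa using hy
        refine (norm_fderiv_le f y).trans ?_
        rw [Finset.sum_mul]
        refine Finset.sum_le_sum fun i _ => (hC i y (hy.trans hx)).trans ?_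
        have := hC0 i
        gcongr) (by simp) (by simp)
    simp only [hf0, sub_zero, Real.norm_eq_abs] at this
    rw [pow_succ, ← mul_assoc]
    exact this

/-- integrability of singular weights -/
lemma integrable_weight {N : ℕ} (hN : 2 ≤ N) {q : EE N → ℝ} (hq : Continuous q)
    (hc : HasCompactSupport q) {n : ℕ} {C r : ℝ}
    (hb : ∀ x : EE N, ‖x‖ ≤ 1 → |q x| ≤ C * ‖x‖ ^ n) (hr : -(N : ℝ) < n + r) :
    Integrable (fun x => q x * ‖x‖ ^ r) := by
  have hfr : Module.finrank ℝ (EE N) = N := by simp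
  have hm : Measurable (fun x : EE N => q x * ‖x‖ ^ r) := by
    have := hq.measurable
    fun_prop
  have : Nontrivial (EE N) := by
    apply Module.nontrivial_of_finrank_pos (R := ℝ)
    rw [hfr]; omega
  have h1 : IntegrableOn (fun x => q x * ‖x‖ ^ r) (Metric.ball (0 : EE N) 1) := by
    apply integrableOn_ball_of_norm_le_rpow (C := C) (α := -(n + r))
    · rw [hfr]; linarith
    · rw [ae_restrict_iff' measurableSet_ball]
      filter_upwards [compl_mem_ae_iff.mpr (measure_singleton (0 : EE N))] with x hx0 hx
      have hx0 : 0 < ‖x‖ := norm_pos_iff.mpr hx0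
      have hx : ‖x‖ ≤ 1 := by simpa using (Metric.mem_ball.mp hx).le
      rw [norm_mul, Real.norm_eq_abs, Real.norm_eq_abs, abs_of_pos (Real.rpow_pos_of_pos hx0 _),
        neg_neg, Real.rpow_add hx0, Real.rpow_natCast, ← mul_assoc]
      gcongr
      exact hb x hx
    · exact hm.aestronglyMeasurable
    · rw [hfr]; omega
  have h2 : IntegrableOn (fun x => q x * ‖x‖ ^ r) (tsupport q \ Metric.ball (0 : EE N) 1) := by
    apply ContinuousOn.integrableOn_compact
    · exact hc.isCompact.diff Metric.isOpen_ball
    · apply hq.continuousOn.mul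
      apply continuous_norm.continuousOn.rpow_const
      intro x hx
      left
      have : 1 ≤ ‖x‖ := by simpa using hx.2
      linarith
  rw [← integrableOn_iff_integrable_of_support_subset
    (s := Metric.ball (0 : EE N) 1 ∪ (tsupport q \ Metric.ball (0 : EE N) 1))]
  · exact h1.union h2
  · intro x hx
    have : q x ≠ 0 := fun h => hx (by simp [h])
    have := subset_tsupport q this
    by_cases h : x ∈ Metric.ball (0 : EE N) 1
    · exact Or.inl h
    · exact Or.inr ⟨this, h⟩

lemma integral_fderiv_zero {N : ℕ} {f : EE N → ℝ} (hf : ContDiff ℝ 1 f)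
    (hc : HasCompactSupport f) (v : EE N) : ∫ x, fderiv ℝ f x v = 0 := by
  have h1 : Integrable (fun x => fderiv ℝ f x v) :=
    ((hf.continuous_fderiv (by simp)).clm_apply continuous_const).integrable_of_hasCompactSupport
      (hc.fderiv_apply (𝕜 := ℝ) v)
  have h2 : Integrable f := hf.continuous.integrable_of_hasCompactSupport hc
  have := integral_mul_fderiv_eq_neg_fderiv_mul_of_integrable (μ := (volume : Measure (EE N)))
    (f := fun _ => (1 : ℝ)) (g := f) (v := v)
    (by simp) (by simpa using h1) (by simpa using h2) (by intro x _; fun_prop)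
    (fun x _ => hf.differentiable (by simp) x)
  simpa using this

lemma integrable_bdd {N : ℕ} {u m g : EE N → ℝ} (hc : HasCompactSupport u) (hm : Measurable m)
    {L : ℝ} (hL : ∀ x, |m x| ≤ L) (hg : Continuous g) (h0 : ∀ x, u x = 0 → m x * g x = 0) :
    Integrable (fun x => m x * g x) := by
  rw [← integrableOn_iff_integrable_of_support_subset (s := tsupport u)]
  · have hgi : IntegrableOn g (tsupport u) := hg.continuousOn.integrableOn_compact hc.isCompact
    exact Integrable.bdd_mul hgi hm.aestronglyMeasurable (c := L) (Filter.Eventually.of_forall hL)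
  · intro x hx
    apply subset_tsupport
    intro h
    exact hx (h0 x h)

lemma hasFDerivAt_phi {N : ℕ} (i j : Fin N) {δ : ℝ} (hδ : 0 < δ) (x : EE N) :
    HasFDerivAt (fun x : EE N => (x i - x j) / ((x i - x j) ^ 2 + δ))
      (((δ - (x i - x j) ^ 2) / ((x i - x j) ^ 2 + δ) ^ 2) •
        ((EuclideanSpace.proj i : EE N →L[ℝ] ℝ) - EuclideanSpace.proj j)) x := by
  have h1 : ∀ t : ℝ, HasDerivAt (fun t : ℝ => t / (t ^ 2 + δ)) ((δ - t ^ 2) / (t ^ 2 + δ) ^ 2) t := by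
    intro t
    have hne : t ^ 2 + δ ≠ 0 := by positivity
    convert! (hasDerivAt_id t).div (((hasDerivAt_id t).pow 2).add_const δ) hne using 1
    simp
    ring
  exact (h1 (x i - x j)).comp_hasFDerivAt x
    ((EuclideanSpace.proj i : EE N →L[ℝ] ℝ) - EuclideanSpace.proj j).hasFDerivAt

lemma abs_phi_le (t δ : ℝ) (hδ : 0 < δ) : |t / (t ^ 2 + δ)| ≤ |t⁻¹| := by
  by_cases ht : t = 0
  · simp [ht]
  · have : 0 < t ^ 2 := by positivity
    have h2 : t⁻¹ = t / t ^ 2 := by field_simp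
    rw [h2, abs_div, abs_div, abs_of_pos this, abs_of_pos (by positivity : 0 < t ^ 2 + δ)]
    gcongr
    linarith

lemma abs_dphi_le (t δ : ℝ) (hδ : 0 < δ) (ht : t ≠ 0) :
    |(δ - t ^ 2) / (t ^ 2 + δ) ^ 2| ≤ (t⁻¹) ^ 2 := by
  have h : 0 < t ^ 2 := by positivity
  rw [abs_div, abs_of_pos (by positivity : 0 < (t ^ 2 + δ) ^ 2), inv_pow]
  calc |δ - t ^ 2| / (t ^ 2 + δ) ^ 2 ≤ (t ^ 2 + δ) / (t ^ 2 + δ) ^ 2 := by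
        gcongr
        rw [abs_le]; constructor <;> linarith
    _ = (t ^ 2 + δ)⁻¹ := by field_simp
    _ ≤ (t ^ 2)⁻¹ := by gcongr; linarith

lemma pair_ibp {N : ℕ} {u g : EE N → ℝ} (hu : ContDiff ℝ (⊤ : ℕ∞) u) (hc : HasCompactSupport u)
    (hg : ContDiff ℝ 1 g) {i j : Fin N} (hij : i ≠ j) {L : ℝ}
    (hL : ∀ x, |u x| ≤ L * |x i - x j|) :
    Integrable (fun x => 2 * u x * (pd i u x - pd j u x) * g x * (x i - x j)⁻¹
      + u x ^ 2 * (pd i g x - pd j g x) * (x i - x j)⁻¹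
      - 2 * u x ^ 2 * g x * (x i - x j)⁻¹ ^ 2) ∧
    ∫ x, (2 * u x * (pd i u x - pd j u x) * g x * (x i - x j)⁻¹
      + u x ^ 2 * (pd i g x - pd j g x) * (x i - x j)⁻¹
      - 2 * u x ^ 2 * g x * (x i - x j)⁻¹ ^ 2) = 0 := by
  have hucont := hu.continuous
  have hgcont := hg.continuous
  have hpu : ∀ k, Continuous (pd k u) := fun k => (pd_smooth hu k).continuous
  have hpg : ∀ k, Continuous (pd k g) := fun k =>
    (hg.continuous_fderiv (by simp)).clm_apply continuous_const
  have hL0 : ∀ x, |u x * (x i - x j)⁻¹| ≤ |L| := by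
    intro x
    by_cases h : x i - x j = 0
    · simp [h]
    · rw [abs_mul, abs_inv]
      have hpos : 0 < |x i - x j| := abs_pos.mpr h
      rw [← div_eq_mul_inv, div_le_iff₀ hpos]
      refine (hL x).trans ?_
      gcongr
      exact le_abs_self L
  have hz : ∀ x : EE N, x i - x j = 0 → u x = 0 := by
    intro x hx
    have := hL x
    rw [hx] at this
    simpa using this
  have hmc : Measurable (fun x : EE N => u x * (x i - x j)⁻¹) := by
    have := hucont.measurable
    fun_prop
  have I1 : Integrable (fun x => (u x * (x i - x j)⁻¹) * (2 * (pd i u x - pd j u x) * g x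
      + u x * (pd i g x - pd j g x))) := by
    apply integrable_bdd hc hmc hL0
    · have := hpu i; have := hpu j; have := hpg i; have := hpg j
      fun_prop
    · intro x hx; simp [hx]
  have I2 : Integrable (fun x => (u x * (x i - x j)⁻¹) ^ 2 * (2 * g x)) := by
    apply integrable_bdd hc (hmc.pow_const 2) (L := |L| ^ 2)
    · intro x; rw [abs_pow]; exact pow_le_pow_left₀ (abs_nonneg _) (hL0 x) 2
    · fun_prop
    · intro x hx; simp [hx]
  have hI : Integrable (fun x => 2 * u x * (pd i u x - pd j u x) * g x * (x i - x j)⁻¹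
      + u x ^ 2 * (pd i g x - pd j g x) * (x i - x j)⁻¹
      - 2 * u x ^ 2 * g x * (x i - x j)⁻¹ ^ 2) := by
    refine (I1.sub I2).congr (Filter.Eventually.of_forall fun x => ?_)
    simp only [Pi.sub_apply]
    ring
  refine ⟨hI, ?_⟩
  -- approximations
  set δ : ℕ → ℝ := fun n => 1 / ((n : ℝ) + 1) with hδdef
  have hδ : ∀ n, 0 < δ n := fun n => by simp only [hδdef]; positivity
  have hδt : Tendsto δ atTop (𝓝 0) := tendsto_one_div_add_atTop_nhds_zero_nat
  let F : ℕ → EE N → ℝ := fun n x =>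
    2 * u x * (pd i u x - pd j u x) * g x * ((x i - x j) / ((x i - x j) ^ 2 + δ n))
      + u x ^ 2 * (pd i g x - pd j g x) * ((x i - x j) / ((x i - x j) ^ 2 + δ n))
      + 2 * u x ^ 2 * g x * ((δ n - (x i - x j) ^ 2) / ((x i - x j) ^ 2 + δ n) ^ 2)
  have hF0 : ∀ n, ∫ x, F n x = 0 := by
    intro n
    have hpos : ∀ x : EE N, (x i - x j) ^ 2 + δ n ≠ 0 := fun x => by have := hδ n; positivity
    have hsm : ContDiff ℝ 1 (fun x : EE N => u x ^ 2 * (g x * ((x i - x j) / ((x i - x j) ^ 2 + δ n)))) := by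
      have h1 : ContDiff ℝ 1 u := hu.of_le (by exact_mod_cast le_top)
      have h2 : ContDiff ℝ 1 (fun x : EE N => (x i - x j) / ((x i - x j) ^ 2 + δ n)) := by
        apply ContDiff.div
        · fun_prop
        · fun_prop
        · exact hpos
      exact (h1.pow 2).mul (hg.mul h2)
    have hcs : HasCompactSupport (fun x : EE N => u x ^ 2 * (g x * ((x i - x j) / ((x i - x j) ^ 2 + δ n)))) := by
      refine hc.mono ?_
      intro x hx h
      exact hx (by simp [h])
    rw [← integral_fderiv_zero hsm hcs (EuclideanSpace.single i 1 - EuclideanSpace.single j 1)]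
    congr 1
    funext x
    have du := ((hu.differentiable (by simp)) x).hasFDerivAt
    have dg := ((hg.differentiable (by simp)) x).hasFDerivAt
    have d := ((du.pow 2).mul (dg.mul (hasFDerivAt_phi i j (hδ n) x))).fderiv
    have e : (fun x : EE N => u x ^ 2 * (g x * ((x i - x j) / ((x i - x j) ^ 2 + δ n)))) =
      ((fun x => u x ^ 2) * (g * fun x : EE N => ((x i - x j) / ((x i - x j) ^ 2 + δ n)))) := rfl
    rw [e, d]
    simp [F, pd, hij, hij.symm]
    ring
  have hlim : Tendsto (fun n => ∫ x, F n x) atTop (𝓝 (∫ x, (2 * u x * (pd i u x - pd j u x) * g x * (x i - x j)⁻¹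
      + u x ^ 2 * (pd i g x - pd j g x) * (x i - x j)⁻¹
      - 2 * u x ^ 2 * g x * (x i - x j)⁻¹ ^ 2))) := by
    apply tendsto_integral_of_dominated_convergence (fun x =>
      |(u x * (x i - x j)⁻¹) * (2 * (pd i u x - pd j u x) * g x
      + u x * (pd i g x - pd j g x))| + |(u x * (x i - x j)⁻¹) ^ 2 * (2 * g x)|)
    · intro n
      have h1 := hucont.measurable
      have h2 := (hpu i).measurable
      have h3 := (hpu j).measurable
      have h4 := (hpg i).measurable
      have h5 := (hpg j).measurable
      have h6 := hgcont.measurable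
      apply Measurable.aestronglyMeasurable
      simp only [F]
      fun_prop
    · exact I1.abs.add I2.abs
    · intro n
      refine Filter.Eventually.of_forall fun x => ?_
      by_cases hx : x i - x j = 0
      · simp [F, hz x hx]
      · have e : F n x = ((x i - x j) / ((x i - x j) ^ 2 + δ n)) * (u x * (2 * (pd i u x - pd j u x) * g x
          + u x * (pd i g x - pd j g x))) +
          ((δ n - (x i - x j) ^ 2) / ((x i - x j) ^ 2 + δ n) ^ 2) * (u x ^ 2 * (2 * g x)) := by
          simp only [F]; ring
        rw [e, Real.norm_eq_abs]
        refine (abs_add_le _ _).trans ?_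
        have e1 : |u x * (x i - x j)⁻¹ * (2 * (pd i u x - pd j u x) * g x
          + u x * (pd i g x - pd j g x))| = |(x i - x j)⁻¹| * |u x * (2 * (pd i u x - pd j u x) * g x
          + u x * (pd i g x - pd j g x))| := by
          rw [← abs_mul]; congr 1; ring
        have e2 : |(u x * (x i - x j)⁻¹) ^ 2 * (2 * g x)| = (x i - x j)⁻¹ ^ 2 * |u x ^ 2 * (2 * g x)| := by
          have e3 : (x i - x j)⁻¹ ^ 2 = |(x i - x j)⁻¹ ^ 2| := (abs_of_nonneg (sq_nonneg _)).symm
          rw [e3, ← abs_mul]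
          congr 1; ring
        rw [e1, e2, abs_mul, abs_mul ((δ n - (x i - x j) ^ 2) / ((x i - x j) ^ 2 + δ n) ^ 2)]
        exact add_le_add (mul_le_mul_of_nonneg_right (abs_phi_le _ _ (hδ n)) (abs_nonneg _))
          (mul_le_mul_of_nonneg_right (abs_dphi_le _ _ (hδ n) hx) (abs_nonneg _))
    · refine Filter.Eventually.of_forall fun x => ?_
      by_cases hx : x i - x j = 0
      · simp [F, hz x hx]
      · have hx2 : (x i - x j) ^ 2 ≠ 0 := by positivity
        have t0 : Tendsto (fun n => (x i - x j) ^ 2 + δ n) atTop (𝓝 ((x i - x j) ^ 2)) := by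
          simpa using hδt.const_add ((x i - x j) ^ 2)
        have t1 : Tendsto (fun n => (x i - x j) / ((x i - x j) ^ 2 + δ n)) atTop (𝓝 ((x i - x j)⁻¹)) := by
          have := (tendsto_const_nhds (x := x i - x j) (f := atTop (α := ℕ))).div t0 hx2
          convert! this using 2
          field_simp
        have t2 : Tendsto (fun n => (δ n - (x i - x j) ^ 2) / ((x i - x j) ^ 2 + δ n) ^ 2) atTop
            (𝓝 (- (x i - x j)⁻¹ ^ 2)) := by
          have := (hδt.sub_const ((x i - x j) ^ 2)).div (t0.pow 2) (by positivity)
          convert! this using 2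
          field_simp
          ring
        have := ((t1.const_mul (2 * u x * (pd i u x - pd j u x) * g x)).add
          (t1.const_mul (u x ^ 2 * (pd i g x - pd j g x)))).add (t2.const_mul (2 * u x ^ 2 * g x))
        convert! this using 2
        ring
  simp only [hF0] at hlim
  exact (tendsto_nhds_unique hlim tendsto_const_nhds)

lemma rad_ibp {N : ℕ} {u g : EE N → ℝ} (hu : ContDiff ℝ (⊤ : ℕ∞) u) (hc : HasCompactSupport u)
    (hg : ContDiff ℝ 1 g) (k : Fin N) :
    Integrable (fun x => 2 * u x * pd k u x * g x * x k + u x ^ 2 * pd k g x * x k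
      + u x ^ 2 * g x) ∧
    ∫ x, (2 * u x * pd k u x * g x * x k + u x ^ 2 * pd k g x * x k + u x ^ 2 * g x) = 0 := by
  have hucont := hu.continuous
  have hgcont := hg.continuous
  have hpu : Continuous (pd k u) := (pd_smooth hu k).continuous
  have hpg : Continuous (pd k g) := (hg.continuous_fderiv (by simp)).clm_apply continuous_const
  constructor
  · apply Continuous.integrable_of_hasCompactSupport
    · fun_prop
    · refine hc.mono ?_
      intro x hx h
      exact hx (by simp [h])
  · have hsm : ContDiff ℝ 1 ((fun x => u x ^ 2) * (g * fun x : EE N => x k)) := by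
      have h1 : ContDiff ℝ 1 u := hu.of_le (by exact_mod_cast le_top)
      exact (h1.pow 2).mul (hg.mul (by fun_prop))
    have hcs : HasCompactSupport ((fun x => u x ^ 2) * (g * fun x : EE N => x k)) := by
      refine hc.mono ?_
      intro x hx h
      exact hx (by simp [h])
    rw [← integral_fderiv_zero hsm hcs (EuclideanSpace.single k 1)]
    congr 1
    funext x
    have du := ((hu.differentiable (by simp)) x).hasFDerivAt
    have dg := ((hg.differentiable (by simp)) x).hasFDerivAt
    have dk : HasFDerivAt (fun x : EE N => x k) (EuclideanSpace.proj k : EE N →L[ℝ] ℝ) x :=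
      (EuclideanSpace.proj k : EE N →L[ℝ] ℝ).hasFDerivAt
    rw [((du.pow 2).mul (dg.mul dk)).fderiv]
    simp [pd]
    ring

lemma pd_weight {N : ℕ} {ε : ℝ} (hε : 0 < ε) (b : ℝ) (k : Fin N) (x : EE N) :
    pd k (fun x : EE N => (‖x‖ ^ 2 + ε) ^ b) x = 2 * b * x k * (‖x‖ ^ 2 + ε) ^ (b - 1) := by
  have h1 : HasFDerivAt (fun x : EE N => ‖x‖ ^ 2 + ε) _ x :=
    ((hasStrictFDerivAt_norm_sq x).hasFDerivAt).add_const ε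
  have hne : ‖x‖ ^ 2 + ε ≠ 0 := by positivity
  have h2 := h1.rpow_const (p := b) (Or.inl hne)
  unfold pd
  rw [h2.fderiv]
  simp [EuclideanSpace.inner_single_right]
  ring

lemma contDiff_weight {N : ℕ} {ε : ℝ} (hε : 0 < ε) (b : ℝ) :
    ContDiff ℝ 1 (fun x : EE N => (‖x‖ ^ 2 + ε) ^ b) := by
  apply ContDiff.rpow_const_of_ne
  · exact (contDiff_norm_sq ℝ).add contDiff_const
  · intro x; positivity

lemma sum_half {N : ℕ} (x D : Fin N → ℝ) :
    ∑ i, ∑ j, (D i - D j) * (x i - x j)⁻¹ = 2 * ∑ i, D i * ∑ j, (x i - x j)⁻¹ := by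
  have h : ∑ i, ∑ j, D j * (x i - x j)⁻¹ = - ∑ i, D i * ∑ j, (x i - x j)⁻¹ := by
    rw [Finset.sum_comm, ← Finset.sum_neg_distrib]
    refine Finset.sum_congr rfl fun i _ => ?_
    rw [← Finset.mul_sum, ← mul_neg, ← Finset.sum_neg_distrib]
    congr 1
    refine Finset.sum_congr rfl fun j _ => ?_
    rw [← inv_neg, neg_sub]
  simp only [sub_mul, Finset.sum_sub_distrib, h]
  simp only [← Finset.mul_sum]
  ring

lemma sum_one {N : ℕ} (x : Fin N → ℝ) (hx : ∀ i j, i ≠ j → x i - x j ≠ 0) :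
    ∑ i, ∑ j, (x i - x j) * (x i - x j)⁻¹ = (N : ℝ) * ((N : ℝ) - 1) := by
  have : ∀ i j, (x i - x j) * (x i - x j)⁻¹ = 1 - if i = j then 1 else 0 := by
    intro i j
    by_cases h : i = j
    · simp [h]
    · simp [h, hx i j h]
  simp only [this, Finset.sum_sub_distrib]
  simp
  ring

lemma sum_sq {N : ℕ} (x : Fin N → ℝ) (hx : ∀ i j, i ≠ j → x i - x j ≠ 0) :
    ∑ i, (∑ j, (x i - x j)⁻¹) ^ 2 = ∑ i, ∑ j, ((x i - x j)⁻¹) ^ 2 := by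
  set c : Fin N → Fin N → ℝ := fun i j => (x i - x j)⁻¹ with hc
  have hT : ∑ i, (∑ j, c i j) ^ 2 = ∑ i, ∑ j, ∑ k, c i j * c i k := by
    refine Finset.sum_congr rfl fun i _ => ?_
    rw [sq, Finset.sum_mul_sum]
  have hpt : ∀ i j k, c i j * c i k + c j k * c j i + c k i * c k j =
      (if i = j then c k i ^ 2 else 0) + (if j = k then c i j ^ 2 else 0)
        + (if k = i then c j k ^ 2 else 0) := by
    intro i j k
    have hcc : ∀ i, c i i = 0 := fun i => by simp [hc]
    by_cases hij : i = j
    · subst hij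
      by_cases hik : i = k
      · subst hik; simp [hcc]
      · simp [hcc, hik, Ne.symm hik, sq]
    · by_cases hjk : j = k
      · subst hjk; simp [hcc, hij, Ne.symm hij, sq]
      · by_cases hki : k = i
        · subst hki; simp [hcc, hij, hjk, sq]
        · simp only [hij, hjk, hki, if_false, hc]
          have h1 := hx i j hij
          have h2 := hx j k hjk
          have h3 := hx k i hki
          have e1 : x i - x k = -(x k - x i) := by ring
          have e2 : x j - x i = -(x i - x j) := by ring
          have e3 : x k - x j = -(x j - x k) := by ring
          rw [e1, e2, e3]
          field_simp
          ring
  have r1 : ∑ i, ∑ j, ∑ k, c j k * c j i = ∑ i, ∑ j, ∑ k, c i j * c i k := by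
    rw [Finset.sum_comm]
    refine Finset.sum_congr rfl fun i _ => ?_
    rw [Finset.sum_comm]
  have r2 : ∑ i, ∑ j, ∑ k, c k i * c k j = ∑ i, ∑ j, ∑ k, c i j * c i k := by
    have : ∀ i, ∑ j, ∑ k, c k i * c k j = ∑ k, ∑ j, c k i * c k j := fun i => Finset.sum_comm
    simp only [this]
    rw [Finset.sum_comm]
  have hsum : ∑ i, ∑ j, ∑ k, (c i j * c i k + c j k * c j i + c k i * c k j) =
      3 * ∑ i, ∑ j, c i j ^ 2 := by
    simp only [hpt, Finset.sum_add_distrib]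
    have a1 : ∑ i, ∑ j, ∑ k, (if i = j then c k i ^ 2 else 0) = ∑ i, ∑ j, c i j ^ 2 := by
      rw [Finset.sum_comm (f := fun i j => ∑ k, (if i = j then c k i ^ 2 else 0))]
      have : ∀ j, ∑ i, ∑ k, (if i = j then c k i ^ 2 else 0) = ∑ k, c k j ^ 2 := by
        intro j
        rw [Finset.sum_comm]
        simp
      simp only [this]
      rw [Finset.sum_comm]
    have a2 : ∑ i, ∑ j, ∑ k, (if j = k then c i j ^ 2 else 0) = ∑ i, ∑ j, c i j ^ 2 := by simp
    have a3 : ∑ i, ∑ j, ∑ k, (if k = i then c j k ^ 2 else 0) = ∑ i, ∑ j, c i j ^ 2 := by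
      simp
      rw [Finset.sum_comm]
    rw [a1, a2, a3]; ring
  simp only [Finset.sum_add_distrib] at hsum
  rw [r1, r2] at hsum
  rw [hT]
  linarith

/-- the pointwise inequality -/
lemma pointwise {N : ℕ} (x D : Fin N → ℝ) (hx : ∀ i j, i ≠ j → x i - x j ≠ 0)
    (y a s P R : ℝ) (hP : 0 < P) :
    y ^ 2 * ((-(a + s) * (N * (N - 1)) - s * N) * (P * R)
        + (-s ^ 2 - 2 * s * (a - 1)) * (∑ i, x i ^ 2) * P)
      ≤ (∑ i, D i ^ 2) * (P * R ^ 2)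
        - (1 / 2 * ∑ i, ∑ j, (2 * y * (D i - D j) * (P * R ^ 2) * (x i - x j)⁻¹
            + y ^ 2 * (2 * a * x i * (P * R) - 2 * a * x j * (P * R)) * (x i - x j)⁻¹
            - 2 * y ^ 2 * (P * R ^ 2) * (x i - x j)⁻¹ ^ 2)
          + s * ∑ k, (2 * y * D k * (P * R) * x k + y ^ 2 * (2 * (a - 1) * x k * P) * x k
            + y ^ 2 * (P * R))) := by
  have A1 := sum_sq x hx
  have A2 := sum_one x hx
  have A3 := sum_half x x
  have A4 := sum_half x D
  set H : Fin N → ℝ := fun i => ∑ j, (x i - x j)⁻¹ with hH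
  have B1 : ∑ i, ∑ j, (2 * y * (D i - D j) * (P * R ^ 2) * (x i - x j)⁻¹
            + y ^ 2 * (2 * a * x i * (P * R) - 2 * a * x j * (P * R)) * (x i - x j)⁻¹
            - 2 * y ^ 2 * (P * R ^ 2) * (x i - x j)⁻¹ ^ 2)
      = 2 * y * (P * R ^ 2) * ∑ i, ∑ j, (D i - D j) * (x i - x j)⁻¹
        + y ^ 2 * 2 * a * (P * R) * ∑ i, ∑ j, (x i - x j) * (x i - x j)⁻¹
        - 2 * y ^ 2 * (P * R ^ 2) * ∑ i, ∑ j, (x i - x j)⁻¹ ^ 2 := by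
    simp only [Finset.mul_sum, ← Finset.sum_add_distrib, ← Finset.sum_sub_distrib]
    refine Finset.sum_congr rfl fun i _ => Finset.sum_congr rfl fun j _ => ?_
    ring
  have B2 : ∑ k, (2 * y * D k * (P * R) * x k + y ^ 2 * (2 * (a - 1) * x k * P) * x k
            + y ^ 2 * (P * R)) = 2 * y * (P * R) * ∑ k, D k * x k
              + y ^ 2 * 2 * (a - 1) * P * ∑ k, x k ^ 2 + N * (y ^ 2 * (P * R)) := by
    rw [Finset.sum_add_distrib, Finset.sum_add_distrib, Finset.mul_sum, Finset.mul_sum]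
    congr 1
    · congr 1 <;> refine Finset.sum_congr rfl fun i _ => ?_ <;> ring
    · simp
  have B3 : ∑ i, P * (D i * R - y * (H i * R + s * x i)) ^ 2 =
      (∑ i, D i ^ 2) * (P * R ^ 2) - 2 * y * P * R ^ 2 * ∑ i, D i * H i
        - 2 * y * s * P * R * ∑ i, D i * x i + y ^ 2 * P * R ^ 2 * ∑ i, H i ^ 2
        + y ^ 2 * P * 2 * R * s * ∑ i, x i * H i + y ^ 2 * P * s ^ 2 * ∑ i, x i ^ 2 := by
    simp only [Finset.mul_sum, Finset.sum_mul, ← Finset.sum_add_distrib, ← Finset.sum_sub_distrib]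
    refine Finset.sum_congr rfl fun i _ => ?_
    ring
  have B4 : 0 ≤ ∑ i, P * (D i * R - y * (H i * R + s * x i)) ^ 2 :=
    Finset.sum_nonneg fun i _ => by positivity
  rw [B3, A1] at B4
  rw [A2] at A3
  have A5 : ∑ i, x i * H i = (N : ℝ) * ((N : ℝ) - 1) / 2 := by linarith
  rw [A5] at B4
  rw [B1, B2, A2, A4]
  linarith

lemma eps_ineq {N : ℕ} {u : EE N → ℝ} (hu : ContDiff ℝ (⊤ : ℕ∞) u) (hc : HasCompactSupport u)
    {L : ℝ} (hL : ∀ i j : Fin N, i ≠ j → ∀ x : EE N, |u x| ≤ L * |x i - x j|) (a s : ℝ)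
    {ε : ℝ} (hε : 0 < ε) :
    ∫ x, u x ^ 2 * ((-(a + s) * (N * (N - 1)) - s * N) * (‖x‖ ^ 2 + ε) ^ (a - 1)
        + (-s ^ 2 - 2 * s * (a - 1)) * ‖x‖ ^ 2 * (‖x‖ ^ 2 + ε) ^ (a - 2))
      ≤ ∫ x, (∑ i, pd i u x ^ 2) * (‖x‖ ^ 2 + ε) ^ a := by
  have hucont := hu.continuous
  have hpu : ∀ k, Continuous (pd k u) := fun k => (pd_smooth hu k).continuous
  have hw : ∀ b : ℝ, Continuous (fun x : EE N => (‖x‖ ^ 2 + ε) ^ b) :=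
    fun b => (contDiff_weight hε b).continuous
  let A : Fin N → Fin N → EE N → ℝ := fun i j x =>
    2 * u x * (pd i u x - pd j u x) * (‖x‖ ^ 2 + ε) ^ a * (x i - x j)⁻¹
      + u x ^ 2 * (pd i (fun x : EE N => (‖x‖ ^ 2 + ε) ^ a) x
          - pd j (fun x : EE N => (‖x‖ ^ 2 + ε) ^ a) x) * (x i - x j)⁻¹
      - 2 * u x ^ 2 * (‖x‖ ^ 2 + ε) ^ a * (x i - x j)⁻¹ ^ 2
  let B : Fin N → EE N → ℝ := fun k x =>
    2 * u x * pd k u x * (‖x‖ ^ 2 + ε) ^ (a - 1) * x k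
      + u x ^ 2 * pd k (fun x : EE N => (‖x‖ ^ 2 + ε) ^ (a - 1)) x * x k
      + u x ^ 2 * (‖x‖ ^ 2 + ε) ^ (a - 1)
  have hA : ∀ i j, Integrable (A i j) ∧ ∫ x, A i j x = 0 := by
    intro i j
    by_cases h : i = j
    · subst h
      have : A i i = fun _ => 0 := by funext x; simp [A]
      rw [this]; simp
    · exact pair_ibp hu hc (contDiff_weight hε a) h (hL i j h)
  have hB : ∀ k, Integrable (B k) ∧ ∫ x, B k x = 0 := fun k =>
    rad_ibp hu hc (contDiff_weight hε (a - 1)) k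
  have hAs : Integrable (fun x => 1 / 2 * ∑ i, ∑ j, A i j x) :=
    (integrable_finsetSum _ fun i _ => integrable_finsetSum _ fun j _ => (hA i j).1).const_mul _
  have hBs : Integrable (fun x => s * ∑ k, B k x) :=
    (integrable_finsetSum _ fun k _ => (hB k).1).const_mul _
  have hA0 : ∫ x, 1 / 2 * ∑ i, ∑ j, A i j x = 0 := by
    rw [integral_const_mul, integral_finsetSum _ fun i _ => integrable_finsetSum _ fun j _ => (hA i j).1]
    have : ∀ i, ∫ x, ∑ j, A i j x = 0 := by
      intro i
      rw [integral_finsetSum _ fun j _ => (hA i j).1]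
      simp [fun j => (hA i j).2]
    simp [this]
  have hB0 : ∫ x, s * ∑ k, B k x = 0 := by
    rw [integral_const_mul, integral_finsetSum _ fun i _ => (hB i).1]
    simp [fun j => (hB j).2]
  have hG : Integrable (fun x => (∑ i, pd i u x ^ 2) * (‖x‖ ^ 2 + ε) ^ a) := by
    apply Continuous.integrable_of_hasCompactSupport
    · have := hw a
      fun_prop
    · refine HasCompactSupport.mul_right ?_
      refine (hc.fderiv (𝕜 := ℝ)).mono ?_
      intro x hx h
      exact hx (by simp [pd, h])
  have hU : Integrable (fun x => u x ^ 2 * ((-(a + s) * (N * (N - 1)) - s * N) * (‖x‖ ^ 2 + ε) ^ (a - 1)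
        + (-s ^ 2 - 2 * s * (a - 1)) * ‖x‖ ^ 2 * (‖x‖ ^ 2 + ε) ^ (a - 2))) := by
    apply Continuous.integrable_of_hasCompactSupport
    · have := hw (a - 1)
      have := hw (a - 2)
      fun_prop
    · refine hc.mono ?_
      intro x hx h
      exact hx (by simp [h])
  have e : ∫ x, (∑ i, pd i u x ^ 2) * (‖x‖ ^ 2 + ε) ^ a =
      ∫ x, ((∑ i, pd i u x ^ 2) * (‖x‖ ^ 2 + ε) ^ a
        - (1 / 2 * ∑ i, ∑ j, A i j x + s * ∑ k, B k x)) := by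
    have e1 := integral_sub hG (hAs.add hBs)
    simp only [Pi.add_apply] at e1
    rw [e1, integral_add hAs hBs, hA0, hB0]
    simp
  rw [e]
  apply integral_mono hU (hG.sub (hAs.add hBs))
  intro x
  simp only [Pi.sub_apply, Pi.add_apply]
  have hR : 0 < ‖x‖ ^ 2 + ε := by positivity
  have hP : 0 < (‖x‖ ^ 2 + ε) ^ (a - 2) := Real.rpow_pos_of_pos hR _
  have p1 : (‖x‖ ^ 2 + ε) ^ (a - 1) = (‖x‖ ^ 2 + ε) ^ (a - 2) * (‖x‖ ^ 2 + ε) := by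
    rw [← Real.rpow_add_one hR.ne']; congr 1; ring
  have p2 : (‖x‖ ^ 2 + ε) ^ a = (‖x‖ ^ 2 + ε) ^ (a - 2) * (‖x‖ ^ 2 + ε) ^ 2 := by
    rw [← Real.rpow_natCast (‖x‖ ^ 2 + ε) 2, ← Real.rpow_add hR]; congr 1; push_cast; ring
  by_cases h0 : ∀ i j : Fin N, i ≠ j → x i - x j ≠ 0
  · have key := pointwise (fun i => x i) (fun i => pd i u x) h0 (u x) a s _ (‖x‖ ^ 2 + ε) hP
    simp only [A, B, pd_weight hε]
    have q : a - 1 - 1 = a - 2 := by ring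
    rw [q, p1, p2]
    have hn : ‖x‖ ^ 2 = ∑ i, x i ^ 2 := by
      rw [EuclideanSpace.norm_sq_eq]; simp
    have key2 := key
    rw [← hn] at key2
    convert! key2 using 1
  · push Not at h0
    obtain ⟨i, j, hij, h⟩ := h0
    have hu0 : u x = 0 := by
      have := hL i j hij x
      rw [h] at this
      simpa using this
    simp only [A, B, hu0]
    have : 0 ≤ (‖x‖ ^ 2 + ε) ^ a := (Real.rpow_pos_of_pos hR _).le
    have h3 : 0 ≤ ∑ i, pd i u x ^ 2 := Finset.sum_nonneg fun i _ => sq_nonneg _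
    simp
    positivity

lemma weight_bound {r ε : ℝ} (hr : 0 < r) (hε : 0 < ε) (hε1 : ε ≤ 1) (b : ℝ) :
    (r ^ 2 + ε) ^ b ≤ r ^ (2 * b) + (r ^ 2 + 1) ^ b := by
  have h2 : r ^ (2 * b) = (r ^ 2) ^ b := by
    rw [Real.rpow_mul hr.le]; norm_num
  have p1 : 0 < (r ^ 2) ^ b := by positivity
  have p2 : 0 < (r ^ 2 + 1) ^ b := by positivity
  rw [h2]
  by_cases hb : 0 ≤ b
  · have : (r ^ 2 + ε) ^ b ≤ (r ^ 2 + 1) ^ b := Real.rpow_le_rpow (by positivity) (by linarith) hb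
    linarith
  · have : (r ^ 2 + ε) ^ b ≤ (r ^ 2) ^ b :=
      Real.rpow_le_rpow_of_nonpos (by positivity) (by linarith) (by linarith)
    linarith

lemma weight_integrable {N : ℕ} {q : EE N → ℝ} (hq : Continuous q) (hc : HasCompactSupport q)
    {b : ℝ} (hi : Integrable (fun x => q x * ‖x‖ ^ (2 * b))) :
    Integrable (fun x => q x * (‖x‖ ^ (2 * b) + (‖x‖ ^ 2 + 1) ^ b)) := by
  have h2 : Integrable (fun x => q x * (‖x‖ ^ 2 + 1) ^ b) := by
    apply Continuous.integrable_of_hasCompactSupport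
    · exact hq.mul (contDiff_weight one_pos b).continuous
    · exact hc.mul_right
  refine (hi.add h2).congr (Filter.Eventually.of_forall fun x => ?_)
  simp only [Pi.add_apply]
  ring

lemma weight_tendsto {r : ℝ} (hr : 0 < r) (b : ℝ) :
    Tendsto (fun n : ℕ => (r ^ 2 + 1 / ((n : ℝ) + 1)) ^ b) atTop (𝓝 (r ^ (2 * b))) := by
  have h2 : r ^ (2 * b) = (r ^ 2) ^ b := by
    rw [Real.rpow_mul hr.le]; norm_num
  rw [h2]
  have t0 : Tendsto (fun n : ℕ => r ^ 2 + 1 / ((n : ℝ) + 1)) atTop (𝓝 (r ^ 2)) := by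
    simpa using tendsto_one_div_add_atTop_nhds_zero_nat.const_add (r ^ 2)
  exact t0.rpow_const (Or.inl (by positivity))

lemma hardy_aux {N : ℕ} (hN : 2 ≤ N) {θ : ℝ} (hθ : 2 * θ < (N : ℝ) ^ 2)
    (u : EE N → ℝ) (hu : ContDiff ℝ (⊤ : ℕ∞) u) (hc : HasCompactSupport u)
    (ha : ∀ i j : Fin N, i ≠ j → ∀ x, u (SS i j x) = - u x) :
    ((((N : ℝ) ^ 2 - 2 * θ) / 2) ^ 2 + (N : ℝ) * ((N : ℝ) - 1) * (θ - 1)) *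
          ∫ x, u x ^ 2 * ‖x‖ ^ (-(2 * θ))
        ≤ ∫ x, (∑ i, pd i u x ^ 2) * ‖x‖ ^ (-(2 * (θ - 1))) := by
  have hucont := hu.continuous
  have hpu : ∀ k, Continuous (pd k u) := fun k => (pd_smooth hu k).continuous
  have : Nontrivial (EE N) := by
    apply Module.nontrivial_of_finrank_pos (R := ℝ)
    simp; omega
  -- Lipschitz bound
  obtain ⟨K, hK⟩ := ContDiff.lipschitzWith_of_hasCompactSupport hc hu (by simp)
  have hL : ∀ i j : Fin N, i ≠ j → ∀ x : EE N, |u x| ≤ (K * 2 : ℝ) * |x i - x j| := by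
    intro i j hij x
    have h1 := hK.dist_le_mul x (SS i j x)
    rw [ha i j hij x, Real.dist_eq, sub_neg_eq_add, dist_eq_norm] at h1
    have h2 : x - SS i j x = (x i - x j) • (EuclideanSpace.single i (1 : ℝ) - EuclideanSpace.single j 1) := by
      ext k
      simp only [PiLp.sub_apply, PiLp.smul_apply, SS_apply, PiLp.single_apply, smul_eq_mul]
      by_cases hki : k = i
      · subst hki; simp [hij]
      · by_cases hkj : k = j
        · subst hkj; simp [hki]
        · simp [Equiv.swap_apply_of_ne_of_ne hki hkj, hki, hkj]
    have h3 : ‖x - SS i j x‖ ≤ |x i - x j| * 2 := by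
      rw [h2, norm_smul, Real.norm_eq_abs]
      gcongr
      refine (norm_sub_le _ _).trans ?_
      simp
      norm_num
    have h4 : |u x + u x| = 2 * |u x| := by rw [← two_mul, abs_mul]; simp
    rw [h4] at h1
    have h5 : (K : ℝ) * ‖x - SS i j x‖ ≤ K * (|x i - x j| * 2) := by gcongr
    have h6 := abs_nonneg (u x)
    linarith
  -- integrability
  obtain ⟨m, hm⟩ : ∃ m, N * (N - 1) / 2 = m + 1 := by
    refine ⟨N * (N - 1) / 2 - 1, ?_⟩
    have : 1 ≤ N * (N - 1) / 2 := by
      rw [Nat.le_div_iff_mul_le two_pos]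
      obtain ⟨k, rfl⟩ : ∃ k, N = k + 2 := ⟨N - 2, by omega⟩
      simp only [Nat.add_succ_sub_one]
      nlinarith
    omega
  have hm2 : (2 : ℝ) * (m + 1) = N * (N - 1) := by
    have h1 : 2 * (m + 1) = N * (N - 1) := by
      rw [← hm]
      exact Nat.mul_div_cancel' (Nat.even_mul_pred_self N).two_dvd
    have h2 : ((2 * (m + 1) : ℕ) : ℝ) = ((N * (N - 1) : ℕ) : ℝ) := by rw [h1]
    push_cast [Nat.cast_sub (show 1 ≤ N by omega)] at h2
    exact h2
  have hz : ∀ l : List (Fin N), l.length < m + 1 → DD l u 0 = 0 := fun l hl =>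
    DD_zero hu ha l (by omega)
  obtain ⟨C, hC0, hC⟩ := vanish_bound (m + 1) u hu hz
  have hD : ∀ i, ∃ C, 0 ≤ C ∧ ∀ x : EE N, ‖x‖ ≤ 1 → |pd i u x| ≤ C * ‖x‖ ^ m := fun i =>
    vanish_bound m (pd i u) (pd_smooth hu i) fun l hl => hz (i :: l) (by simpa using hl)
  choose Cd hCd_nonneg hCd using hD
  have cu : Continuous (fun x => u x ^ 2) := by fun_prop
  have cD : Continuous (fun x => ∑ i, pd i u x ^ 2) := by fun_prop
  have su : HasCompactSupport (fun x => u x ^ 2) := by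
    refine hc.mono ?_
    intro x hx h
    exact hx (by simp [h])
  have sD : HasCompactSupport (fun x => ∑ i, pd i u x ^ 2) := by
    refine (hc.fderiv (𝕜 := ℝ)).mono ?_
    intro x hx h
    exact hx (by simp [pd, h])
  have Iu : Integrable (fun x => u x ^ 2 * ‖x‖ ^ (2 * (-θ))) := by
    apply integrable_weight hN cu su (n := (m + 1) * 2) (C := C ^ 2)
    · intro x hx
      rw [abs_pow, pow_mul, ← mul_pow]
      exact pow_le_pow_left₀ (abs_nonneg _) (hC x hx) 2
    · push_cast
      nlinarith
  have ID : Integrable (fun x => (∑ i, pd i u x ^ 2) * ‖x‖ ^ (2 * (1 - θ))) := by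
    apply integrable_weight hN cD sD (n := m * 2) (C := ∑ i, Cd i ^ 2)
    · intro x hx
      rw [abs_of_nonneg (Finset.sum_nonneg fun i _ => sq_nonneg _), Finset.sum_mul]
      refine Finset.sum_le_sum fun i _ => ?_
      rw [← sq_abs, pow_mul, ← mul_pow]
      exact pow_le_pow_left₀ (abs_nonneg _) (hCd i x hx) 2
    · push_cast
      nlinarith
  set s : ℝ := -(((N : ℝ) ^ 2 - 2 * θ) / 2) with hs
  set a : ℝ := 1 - θ with hadef
  set α : ℝ := -(a + s) * (N * (N - 1)) - s * N with hα
  set β : ℝ := -s ^ 2 - 2 * s * (a - 1) with hβ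
  have hab : (((N : ℝ) ^ 2 - 2 * θ) / 2) ^ 2 + (N : ℝ) * ((N : ℝ) - 1) * (θ - 1) = α + β := by
    rw [hα, hβ, hs, hadef]; ring
  have hneps : ∀ n : ℕ, 0 < 1 / ((n : ℝ) + 1) := fun n => by positivity
  have hneps1 : ∀ n : ℕ, 1 / ((n : ℝ) + 1) ≤ 1 := fun n => by
    rw [div_le_one (by positivity)]
    have : (0 : ℝ) ≤ n := by positivity
    linarith
  have hae : ∀ᵐ x : EE N, 0 < ‖x‖ := by
    filter_upwards [compl_mem_ae_iff.mpr (measure_singleton (0 : EE N))] with x hx0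
    exact norm_pos_iff.mpr hx0
  have ea : a - 1 = -θ := by rw [hadef]; ring
  have T1 : Tendsto (fun n : ℕ => ∫ x, (∑ i, pd i u x ^ 2) * (‖x‖ ^ 2 + 1 / ((n : ℝ) + 1)) ^ a) atTop
      (𝓝 (∫ x, (∑ i, pd i u x ^ 2) * ‖x‖ ^ (2 * a))) := by
    apply tendsto_integral_of_dominated_convergence _ _ (weight_integrable cD sD ID)
    · intro n
      filter_upwards [hae] with x hx
      have h1 : 0 ≤ ∑ i, pd i u x ^ 2 := Finset.sum_nonneg fun i _ => sq_nonneg _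
      rw [Real.norm_eq_abs, abs_of_nonneg (by positivity)]
      exact mul_le_mul_of_nonneg_left (weight_bound hx (hneps n) (hneps1 n) a) h1
    · filter_upwards [hae] with x hx
      exact (weight_tendsto hx a).const_mul _
    · intro n
      exact (cD.mul (contDiff_weight (hneps n) a).continuous).aestronglyMeasurable
  have T2 : Tendsto (fun n : ℕ => ∫ x, u x ^ 2 * (α * (‖x‖ ^ 2 + 1 / ((n : ℝ) + 1)) ^ (a - 1)
        + β * ‖x‖ ^ 2 * (‖x‖ ^ 2 + 1 / ((n : ℝ) + 1)) ^ (a - 2))) atTop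
      (𝓝 (∫ x, (α + β) * (u x ^ 2 * ‖x‖ ^ (2 * (-θ))))) := by
    apply tendsto_integral_of_dominated_convergence _ _
      ((weight_integrable cu su Iu).const_mul (|α| + |β|))
    · intro n
      filter_upwards [hae] with x hx
      have hR : 0 < ‖x‖ ^ 2 + 1 / ((n : ℝ) + 1) := by positivity
      have hw := weight_bound hx (hneps n) (hneps1 n) (-θ)
      rw [ea]
      set R := ‖x‖ ^ 2 + 1 / ((n : ℝ) + 1) with hRdef
      have p1 : R ^ (-θ) = R ^ (a - 2) * R := by
        rw [← Real.rpow_add_one hR.ne']; congr 1; rw [hadef]; ring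
      have hP : 0 < R ^ (a - 2) := Real.rpow_pos_of_pos hR _
      have hxR : ‖x‖ ^ 2 ≤ R := by have := hneps n; rw [hRdef]; linarith
      have h1 : |α * R ^ (-θ) + β * ‖x‖ ^ 2 * R ^ (a - 2)| ≤ (|α| + |β|) * R ^ (-θ) := by
        refine (abs_add_le _ _).trans ?_
        rw [abs_mul, abs_mul, abs_mul, abs_of_pos hP, abs_of_pos (Real.rpow_pos_of_pos hR (-θ)),
          abs_of_nonneg (sq_nonneg ‖x‖), add_mul, mul_assoc |β|]
        have : ‖x‖ ^ 2 * R ^ (a - 2) ≤ R ^ (-θ) := by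
          rw [p1, mul_comm]
          exact mul_le_mul_of_nonneg_left hxR hP.le
        have := mul_le_mul_of_nonneg_left this (abs_nonneg β)
        linarith
      rw [Real.norm_eq_abs, abs_mul, abs_of_nonneg (sq_nonneg (u x))]
      calc u x ^ 2 * |α * R ^ (-θ) + β * ‖x‖ ^ 2 * R ^ (a - 2)|
          ≤ u x ^ 2 * ((|α| + |β|) * (‖x‖ ^ (2 * (-θ)) + (‖x‖ ^ 2 + 1) ^ (-θ))) := by
            refine mul_le_mul_of_nonneg_left (h1.trans ?_) (sq_nonneg _)
            exact mul_le_mul_of_nonneg_left hw (by positivity)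
        _ = _ := by ring
    · filter_upwards [hae] with x hx
      have t1 := (weight_tendsto hx (a - 1)).const_mul α
      have t2 := (weight_tendsto hx (a - 2)).const_mul (β * ‖x‖ ^ 2)
      have t3 := (t1.add t2).const_mul (u x ^ 2)
      convert! t3 using 2
      have e1 : ‖x‖ ^ (2 * (a - 1)) = ‖x‖ ^ 2 * ‖x‖ ^ (2 * (a - 2)) := by
        rw [← Real.rpow_natCast ‖x‖ 2, ← Real.rpow_add hx]; congr 1; push_cast; ring
      rw [mul_assoc β, ← e1, ea]
      ring
    · intro n
      have := (contDiff_weight (N := N) (hneps n) (a - 1)).continuous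
      have := (contDiff_weight (N := N) (hneps n) (a - 2)).continuous
      apply Continuous.aestronglyMeasurable
      fun_prop
  have fin := le_of_tendsto_of_tendsto' T2 T1 (fun n => eps_ineq hu hc hL a s (hneps n))
  rw [integral_const_mul] at fin
  rw [hab]
  have e2 : -(2 * θ) = 2 * (-θ) := by ring
  have e3 : -(2 * (θ - 1)) = 2 * a := by rw [hadef]; ring
  rw [e2, e3]
  exact fin

/-- **Hardy inequality for antisymmetric functions on `ℝ^N`** (`N² > 2θ`):
for every real-valued `u ∈ C^∞_c(ℝ^N)` that is antisymmetric under transpositions of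
coordinates,
`∫ |∇u|² |x|^{-2(θ-1)} ≥ [((N²-2θ)/2)² + N(N-1)(θ-1)] ∫ |u|² |x|^{-2θ}`. -/
theorem hardy_antisymmetric
    {N : ℕ} (hN : 2 ≤ N) {θ : ℝ} (hθ : 2 * θ < (N : ℝ) ^ 2) :
    ∀ u : EuclideanSpace ℝ (Fin N) → ℝ,
      ContDiff ℝ (⊤ : ℕ∞) u → HasCompactSupport u →
      (∀ i j : Fin N, i ≠ j → ∀ x : EuclideanSpace ℝ (Fin N),
        u ((WithLp.equiv 2 (Fin N → ℝ)).symm (fun k => x (Equiv.swap i j k))) = -u x) →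
      ((((N : ℝ) ^ 2 - 2 * θ) / 2) ^ 2 + (N : ℝ) * ((N : ℝ) - 1) * (θ - 1)) *
          ∫ x, u x ^ 2 * ‖x‖ ^ (-(2 * θ))
        ≤ ∫ x, (∑ i, fderiv ℝ u x (EuclideanSpace.single i 1) ^ 2) *
            ‖x‖ ^ (-(2 * (θ - 1))) := by
  intro u hu hc ha
  exact hardy_aux hN hθ u hu hc (fun i j hij x => by rw [← SS_eq]; exact ha i j hij x)
end
end

section
/- Let N ≥ 1 and let p ≥ 2 be a real number. Let W : ℝ^N \ {0} → ℝ be measurable, locally integrable on ℝ^N \ {0}, with W(x) ≥ 0 for almost every x. Assume that for every u ∈ C^∞_c(ℝ^N \ {0};ℂ): ∫_{ℝ^N} |∇u(x)·(x/|x|)|^p dx ≥ |(N − p)/p|^p ∫_{ℝ^N} |u(x)|^p |x|^{−p} dx + ∫_{ℝ^N} W(x) |u(x)|^p dx. Then W(x) = 0 for almost every x ∈ ℝ^N. -/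
open MeasureTheory Real

noncomputable section
/-- radial change of variables -/
lemma radial_int {N : ℕ} (hN : 1 ≤ N) (h : ℝ → ℝ) (n : ℝ) (hn : 0 < n) :
    ∫ x : EuclideanSpace ℝ (Fin N), ‖x‖⁻¹ ^ N * h (log ‖x‖ / n)
      = (N * volume.real (Metric.ball (0 : EuclideanSpace ℝ (Fin N)) 1)) * n * ∫ s, h s := by
  have : Nonempty (Fin N) := ⟨⟨0, hN⟩⟩
  have := integral_fun_norm_addHaar (volume : Measure (EuclideanSpace ℝ (Fin N)))
    (fun r => r⁻¹ ^ N * h (log r / n))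
  rw [this]
  have himg : Set.Ioi (0:ℝ) = (fun s => exp (n * s)) '' Set.univ := by
    ext y
    simp only [Set.mem_Ioi, Set.image_univ, Set.mem_range]
    constructor
    · intro hy
      exact ⟨log y / n, by rw [mul_div_cancel₀ _ hn.ne', exp_log hy]⟩
    · rintro ⟨s, rfl⟩
      positivity
  rw [himg, integral_image_eq_integral_abs_deriv_smul (f' := fun s => n * exp (n * s))
    MeasurableSet.univ]
  · simp only [finrank_euclideanSpace, Fintype.card_fin, smul_eq_mul, Measure.restrict_univ, log_exp,
      nsmul_eq_mul]
    rw [mul_assoc, mul_assoc]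
    congr 2
    rw [← integral_const_mul]
    congr 1
    ext s
    rw [mul_div_cancel_left₀ _ hn.ne', abs_of_pos (by positivity)]
    obtain ⟨k, rfl⟩ : ∃ k, N = k + 1 := ⟨N - 1, by omega⟩
    have := exp_pos (n * s)
    simp only [Nat.add_sub_cancel, inv_pow]
    field_simp
    ring
  · intro s _
    have := ((hasDerivAt_id s).const_mul n).exp
    simp at this
    rw [mul_comm]
    exact this.hasDerivWithinAt
  · intro a _ b _ hab
    simpa [hn.ne'] using hab

lemma F_deriv {p : ℝ} (hp : 2 ≤ p) (γ : ℝ) (φ : ℝ → ℝ) (hφ : ContDiff ℝ (⊤ : ℕ∞) φ)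
    (hc : HasCompactSupport φ) (he : ∀ s, φ (-s) = φ s) :
    HasDerivAt (fun ε : ℝ => ∫ s, |ε * deriv φ s - γ * φ s| ^ p) 0 0 := by
  have hφc := hφ.continuous
  have hdc : Continuous (deriv φ) := hφ.continuous_deriv (by simp)
  have hcd : HasCompactSupport (deriv φ) := hc.deriv
  have hodd : ∀ s, deriv φ (-s) = - deriv φ s := by
    intro s
    have h1 : (fun s => φ (-s)) = φ := funext he
    have h2 := deriv_comp_neg φ s
    rw [h1] at h2
    rw [h2, neg_neg]
  have hcont : ∀ ε : ℝ, Continuous (fun s => |ε * deriv φ s - γ * φ s| ^ p) := fun ε =>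
    Continuous.rpow_const (by fun_prop) (fun _ => Or.inr (by linarith))
  have key := hasDerivAt_integral_of_dominated_loc_of_deriv_le (μ := (volume : Measure ℝ))
    (F := fun (ε : ℝ) s => |ε * deriv φ s - γ * φ s| ^ p)
    (F' := fun (ε : ℝ) s => (p * |ε * deriv φ s - γ * φ s| ^ (p - 2) * (ε * deriv φ s - γ * φ s)) * deriv φ s)
    (x₀ := 0) (s := Metric.ball 0 1)
    (bound := fun s => (p * (|deriv φ s| + |γ| * |φ s|) ^ (p - 2) * (|deriv φ s| + |γ| * |φ s|)) * |deriv φ s|)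
    (Metric.ball_mem_nhds _ one_pos)
    (Filter.Eventually.of_forall fun ε => (hcont ε).aestronglyMeasurable) ?_ ?_ ?_ ?_ ?_
  · have h0 := key.2
    set g : ℝ → ℝ := fun s => p * |0 * deriv φ s - γ * φ s| ^ (p - 2) * (0 * deriv φ s - γ * φ s) * deriv φ s with hg
    have h1 : ∫ s, g (-s) = ∫ s, g s := integral_neg_eq_self g volume
    have h2 : ∀ s, g (-s) = - g s := by
      intro s
      simp only [hg, hodd, he]
      ring_nf
    simp only [h2, integral_neg] at h1
    have hz : ∫ a, g a = 0 := by linarith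
    have h3 : HasDerivAt (fun ε : ℝ => ∫ s, |ε * deriv φ s - γ * φ s| ^ p) (∫ a, g a) 0 := h0
    rw [hz] at h3
    exact h3
  · refine (hcont 0).integrable_of_hasCompactSupport ?_
    refine hc.mono ?_
    intro s hs
    simp only [Function.mem_support] at hs ⊢
    intro h
    apply hs
    simp [h, zero_rpow (by linarith : p ≠ 0)]
  · refine Continuous.aestronglyMeasurable ?_
    have : Continuous (fun s => |0 * deriv φ s - γ * φ s| ^ (p - 2)) :=
      Continuous.rpow_const (by fun_prop) (fun _ => Or.inr (by linarith))
    fun_prop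
  · refine Filter.Eventually.of_forall fun s ε hε => ?_
    have hε1 : |ε| ≤ 1 := by
      have := Metric.mem_ball.1 hε
      rw [dist_zero_right, norm_eq_abs] at this
      exact this.le
    have hle : |ε * deriv φ s - γ * φ s| ≤ |deriv φ s| + |γ| * |φ s| := by
      calc _ ≤ |ε * deriv φ s| + |γ * φ s| := abs_sub _ _
        _ ≤ _ := by
          rw [abs_mul, abs_mul]
          gcongr
          exact mul_le_of_le_one_left (abs_nonneg _) hε1
    rw [norm_eq_abs, abs_mul, abs_mul, abs_mul, abs_of_nonneg (by linarith : 0 ≤ p),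
      abs_of_nonneg (rpow_nonneg (abs_nonneg _) _)]
    have : 0 ≤ p - 2 := by linarith
    gcongr
  · refine Continuous.integrable_of_hasCompactSupport ?_ ?_
    · have : Continuous (fun s => (|deriv φ s| + |γ| * |φ s|) ^ (p - 2)) :=
        Continuous.rpow_const (by fun_prop) (fun _ => Or.inr (by linarith))
      fun_prop
    · refine hcd.mono ?_
      intro s hs
      simp only [Function.mem_support] at hs ⊢
      intro h
      apply hs
      simp [h]
  · refine Filter.Eventually.of_forall fun s ε hε => ?_
    have h1 : HasDerivAt (fun ε : ℝ => ε * deriv φ s - γ * φ s) (deriv φ s) ε := by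
      simpa using ((hasDerivAt_id ε).mul_const (deriv φ s)).sub_const (γ * φ s)
    exact (hasDerivAt_abs_rpow (ε * deriv φ s - γ * φ s) (by linarith : 1 < p)).comp ε h1

/-- The test function. -/
def testU {N : ℕ} (γ : ℝ) (φ : ℝ → ℝ) (n : ℝ) (x : EuclideanSpace ℝ (Fin N)) : ℂ :=
  if x = 0 then 0 else ((‖x‖ ^ (-γ) * φ (log ‖x‖ / n) : ℝ) : ℂ)

/-- Closed annuli. -/
def ann (N : ℕ) (R : ℝ) : Set (EuclideanSpace ℝ (Fin N)) :=
  {x | exp (-R) ≤ ‖x‖ ∧ ‖x‖ ≤ exp R}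

lemma ann_closed (N : ℕ) (R : ℝ) : IsClosed (ann N R) :=
  (isClosed_le continuous_const continuous_norm).inter (isClosed_le continuous_norm continuous_const)

lemma ann_compact (N : ℕ) (R : ℝ) : IsCompact (ann N R) :=
  (isCompact_closedBall (0 : EuclideanSpace ℝ (Fin N)) (exp R)).of_isClosed_subset (ann_closed N R)
    (fun x hx => by simpa using hx.2)

lemma ann_ne (N : ℕ) (R : ℝ) : ann N R ⊆ {x : EuclideanSpace ℝ (Fin N) | x ≠ 0} := by
  rintro x hx rfl
  have := hx.1
  rw [norm_zero] at this
  exact absurd this (not_le.2 (exp_pos _))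

lemma mem_ann {N : ℕ} {R : ℝ} {x : EuclideanSpace ℝ (Fin N)} (hx : x ≠ 0) :
    x ∈ ann N R ↔ |log ‖x‖| ≤ R := by
  have h := norm_pos_iff.2 hx
  rw [abs_le, le_log_iff_exp_le h, log_le_iff_le_exp h]
  rfl

section
variable {N : ℕ} {γ : ℝ} {φ : ℝ → ℝ} {n : ℝ}

lemma testU_support (hn : 0 < n) (h0 : ∀ s, 2 ≤ |s| → φ s = 0) :
    Function.support (testU (N := N) γ φ n) ⊆ ann N (2 * n) := by
  intro x hx
  rw [Function.mem_support] at hx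
  have hx0 : x ≠ 0 := by
    rintro rfl
    exact hx (by simp [testU])
  rw [mem_ann hx0]
  by_contra hlt
  push Not at hlt
  apply hx
  have : φ (log ‖x‖ / n) = 0 := by
    apply h0
    rw [abs_div, abs_of_pos hn, le_div_iff₀ hn]
    exact hlt.le
  simp [testU, this]

lemma testU_tsupport (hn : 0 < n) (h0 : ∀ s, 2 ≤ |s| → φ s = 0) :
    tsupport (testU (N := N) γ φ n) ⊆ ann N (2 * n) :=
  closure_minimal (testU_support hn h0) (ann_closed _ _)

lemma testU_compact (hn : 0 < n) (h0 : ∀ s, 2 ≤ |s| → φ s = 0) :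
    HasCompactSupport (testU (N := N) γ φ n) :=
  (ann_compact N (2 * n)).of_isClosed_subset (isClosed_tsupport _) (testU_tsupport hn h0)

lemma testU_contDiff (hn : 0 < n) (hφ : ContDiff ℝ (⊤ : ℕ∞) φ) (h0 : ∀ s, 2 ≤ |s| → φ s = 0) :
    ContDiff ℝ (⊤ : ℕ∞) (testU (N := N) γ φ n) := by
  rw [contDiff_iff_contDiffAt]
  intro x
  by_cases hx : x = 0
  · have : testU (N := N) γ φ n =ᶠ[nhds x] fun _ => 0 := by
      have hmem : (ann N (2 * n))ᶜ ∈ nhds x :=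
        (ann_closed N (2 * n)).isOpen_compl.mem_nhds (fun h => ann_ne _ _ h hx)
      filter_upwards [hmem] with y hy
      by_contra h
      exact hy (testU_support hn h0 h)
    exact contDiffAt_const.congr_of_eventuallyEq this
  · have : testU (N := N) γ φ n =ᶠ[nhds x]
        fun x => ((‖x‖ ^ (-γ) * φ (log ‖x‖ / n) : ℝ) : ℂ) := by
      filter_upwards [isOpen_ne.mem_nhds hx] with y hy
      simp only [testU, if_neg hy]
    refine ContDiffAt.congr_of_eventuallyEq ?_ this
    have hnorm : ContDiffAt ℝ (⊤ : ℕ∞) (fun x : EuclideanSpace ℝ (Fin N) => ‖x‖) x := contDiffAt_norm ℝ hx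
    have hne : ‖x‖ ≠ 0 := norm_ne_zero_iff.2 hx
    refine Complex.ofRealCLM.contDiff.contDiffAt.comp x ?_
    exact (hnorm.rpow_const_of_ne hne).mul
      (hφ.contDiffAt.comp x ((hnorm.log hne).div_const n))

lemma testU_deriv (hn : 0 < n) (hφ : ContDiff ℝ (⊤ : ℕ∞) φ) (h0 : ∀ s, 2 ≤ |s| → φ s = 0)
    {x : EuclideanSpace ℝ (Fin N)} (hx : x ≠ 0) :
    fderiv ℝ (testU γ φ n) x (‖x‖⁻¹ • x) =
      ((‖x‖ ^ (-γ - 1) * (n⁻¹ * deriv φ (log ‖x‖ / n) - γ * φ (log ‖x‖ / n)) : ℝ) : ℂ) := by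
  have hr : 0 < ‖x‖ := norm_pos_iff.2 hx
  have hd : DifferentiableAt ℝ (testU (N := N) γ φ n) x :=
    ((testU_contDiff hn hφ h0).differentiable (by simp)) x
  rw [← hd.lineDeriv_eq_fderiv]
  have hv : HasDerivAt (fun r : ℝ => r ^ (-γ) * φ (log r / n))
      (‖x‖ ^ (-γ - 1) * (n⁻¹ * deriv φ (log ‖x‖ / n) - γ * φ (log ‖x‖ / n))) (‖x‖ + 0) := by
    rw [add_zero]
    have h1 := (hasDerivAt_rpow_const (x := ‖x‖) (p := -γ) (Or.inl hr.ne'))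
    have h2 := ((hφ.differentiable (by simp)) (log ‖x‖ / n)).hasDerivAt.comp ‖x‖
      ((hasDerivAt_log hr.ne').div_const n)
    refine (h1.mul h2).congr_deriv ?_
    simp only [Function.comp_apply]
    rw [rpow_sub_one hr.ne']
    field_simp
    ring
  have hv2 := (hv.comp_const_add ‖x‖ 0).ofReal_comp
  have : (fun t : ℝ => testU γ φ n (x + t • (‖x‖⁻¹ • x))) =ᶠ[nhds 0]
      fun t : ℝ => (((‖x‖ + t) ^ (-γ) * φ (log (‖x‖ + t) / n) : ℝ) : ℂ) := by
    filter_upwards [isOpen_Ioi.mem_nhds (show (0:ℝ) ∈ Set.Ioi (-‖x‖) by simpa using hx)] with t ht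
    have ht' : 0 < ‖x‖ + t := by
      have := Set.mem_Ioi.1 ht
      linarith
    have hnorm : ‖x + t • (‖x‖⁻¹ • x)‖ = ‖x‖ + t := by
      have : x + t • (‖x‖⁻¹ • x) = ((‖x‖ + t) * ‖x‖⁻¹) • x := by
        rw [add_mul, mul_inv_cancel₀ hr.ne', add_smul, one_smul, smul_smul]
      rw [this, norm_smul, norm_mul, norm_inv, norm_norm, norm_eq_abs, abs_of_pos ht']
      field_simp
    have hne : x + t • (‖x‖⁻¹ • x) ≠ 0 := by
      rw [← norm_pos_iff, hnorm]
      exact ht'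
    simp only [testU, if_neg hne, hnorm]
  exact (hv2.congr_of_eventuallyEq this).deriv

end

/-- **Criticality of the Hardy inequality in `ℝ^N`**. -/
theorem hardy_criticality
    {N : ℕ} (hN : 1 ≤ N)
    {p : ℝ} (hp : 2 ≤ p)
    (W : EuclideanSpace ℝ (Fin N) → ℝ)
    (hWmeas : Measurable W)
    (hWloc : LocallyIntegrableOn W {x : EuclideanSpace ℝ (Fin N) | x ≠ 0} volume)
    (hWpos : ∀ᵐ x : EuclideanSpace ℝ (Fin N), 0 ≤ W x)
    (hineq : ∀ u : EuclideanSpace ℝ (Fin N) → ℂ,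
      ContDiff ℝ (⊤ : ℕ∞) u → HasCompactSupport u →
      tsupport u ⊆ {x : EuclideanSpace ℝ (Fin N) | x ≠ 0} →
      |((N : ℝ) - p) / p| ^ p * (∫ x, ‖u x‖ ^ p * ‖x‖ ^ (-p))
          + (∫ x, W x * ‖u x‖ ^ p)
        ≤ ∫ x, ‖fderiv ℝ u x (‖x‖⁻¹ • x)‖ ^ p) :
    ∀ᵐ x : EuclideanSpace ℝ (Fin N), W x = 0 := by
  have : Nonempty (Fin N) := ⟨⟨0, hN⟩⟩
  have hp0 : 0 < p := by linarith
  set γ : ℝ := ((N : ℝ) - p) / p with hγ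
  have hγp : (-γ - 1) * p = -(N : ℝ) := by
    rw [hγ]
    field_simp
    ring
  let b : ContDiffBump (0 : ℝ) := ⟨1, 2, one_pos, one_lt_two⟩
  let φ : ℝ → ℝ := b
  have hφ : ContDiff ℝ (⊤ : ℕ∞) φ := b.contDiff
  have h0 : ∀ s, 2 ≤ |s| → φ s = 0 := fun s hs => b.zero_of_le_dist (by simpa [b] using hs)
  have h1 : ∀ s, |s| ≤ 1 → φ s = 1 := fun s hs => b.one_of_mem_closedBall (by simpa [b] using hs)
  have hF := F_deriv hp γ φ hφ b.hasCompactSupport b.neg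
  set F : ℝ → ℝ := fun ε : ℝ => ∫ s, |ε * deriv φ s - γ * φ s| ^ p with hFdef
  set c : ℝ := N * volume.real (Metric.ball (0 : EuclideanSpace ℝ (Fin N)) 1) with hc
  have hpow : ∀ x : EuclideanSpace ℝ (Fin N), x ≠ 0 → ‖x‖ ^ (-(N:ℝ)) = ‖x‖⁻¹ ^ N := by
    intro x hx
    rw [rpow_neg (norm_nonneg _), rpow_natCast, inv_pow]
  have hae : ∀ᵐ x : EuclideanSpace ℝ (Fin N), x ≠ 0 := Measure.ae_ne volume 0
  -- main estimate
  have main : ∀ n : ℝ, 0 < n →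
      ∫ x : EuclideanSpace ℝ (Fin N), W x * ‖testU γ φ n x‖ ^ p ≤ c * (n * (F n⁻¹ - F 0)) := by
    intro n hn
    have hi := hineq (testU γ φ n) (testU_contDiff hn hφ h0) (testU_compact hn h0)
      ((testU_tsupport hn h0).trans (ann_ne _ _))
    have e1 : ∫ x : EuclideanSpace ℝ (Fin N), ‖testU γ φ n x‖ ^ p * ‖x‖ ^ (-p)
        = c * n * ∫ s, |φ s| ^ p := by
      rw [hc, ← radial_int hN (fun s => |φ s| ^ p) n hn]
      refine integral_congr_ae ?_
      filter_upwards [hae] with x hx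
      have hr : 0 < ‖x‖ := norm_pos_iff.2 hx
      simp only [testU, if_neg hx]
      rw [Complex.norm_real, norm_mul, norm_eq_abs, norm_eq_abs, abs_of_pos (rpow_pos_of_pos hr _),
        mul_rpow (by positivity) (by positivity), ← rpow_mul hr.le, ← hpow x hx, mul_right_comm,
        ← rpow_add hr, ← hγp]
      congr 2
      ring
    have e2 : ∫ x : EuclideanSpace ℝ (Fin N), ‖fderiv ℝ (testU γ φ n) x (‖x‖⁻¹ • x)‖ ^ p
        = c * n * F n⁻¹ := by
      rw [hc, hFdef, ← radial_int hN (fun s => |n⁻¹ * deriv φ s - γ * φ s| ^ p) n hn]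
      refine integral_congr_ae ?_
      filter_upwards [hae] with x hx
      have hr : 0 < ‖x‖ := norm_pos_iff.2 hx
      rw [testU_deriv hn hφ h0 hx]
      rw [Complex.norm_real, norm_mul, norm_eq_abs, norm_eq_abs, abs_of_pos (rpow_pos_of_pos hr _),
        mul_rpow (by positivity) (by positivity), ← rpow_mul hr.le, ← hpow x hx, hγp]
    have e3 : F 0 = |γ| ^ p * ∫ s, |φ s| ^ p := by
      rw [← integral_const_mul]
      refine integral_congr_ae (Filter.Eventually.of_forall fun s => ?_)
      beta_reduce
      rw [zero_mul, zero_sub, abs_neg, abs_mul, mul_rpow (abs_nonneg _) (abs_nonneg _)]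
    rw [e1, e2] at hi
    rw [mul_sub, mul_sub, e3]
    linarith
  have hlim : Filter.Tendsto (fun k : ℕ => c * ((k:ℝ) * (F (k:ℝ)⁻¹ - F 0))) Filter.atTop (nhds 0) := by
    have hs := hasDerivAt_iff_tendsto_slope.1 hF
    have hk : Filter.Tendsto (fun k : ℕ => (k:ℝ)⁻¹) Filter.atTop (nhdsWithin 0 {0}ᶜ) := by
      refine tendsto_nhdsWithin_iff.2 ⟨tendsto_inv_atTop_nhds_zero_nat, ?_⟩
      filter_upwards [Filter.eventually_gt_atTop 0] with k hk
      simpa using hk.ne'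
    have := (hs.comp hk).const_mul c
    rw [mul_zero] at this
    refine this.congr fun k => ?_
    simp [slope]
  -- conclusion on each annulus
  have hann : ∀ m : ℕ, ∀ᵐ x : EuclideanSpace ℝ (Fin N), x ∈ ann N m → W x = 0 := by
    intro m
    set g : EuclideanSpace ℝ (Fin N) → ℝ := fun x => W x * (‖x‖ ^ (-γ)) ^ p with hg
    have hgi : IntegrableOn g (ann N m) := by
      refine IntegrableOn.mul_continuousOn
        (hWloc.integrableOn_compact_subset (ann_ne _ _) (ann_compact N m)) ?_ (ann_compact N m)
      intro x hx
      have hne : ‖x‖ ≠ 0 := norm_ne_zero_iff.2 (ann_ne _ _ hx)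
      exact ((continuous_norm.continuousAt.rpow_const (Or.inl hne)).rpow_const
        (Or.inr hp0.le)).continuousWithinAt
    have hg0 : ∀ᵐ x, 0 ≤ g x := by
      filter_upwards [hWpos] with x hx
      have := norm_nonneg x
      positivity
    have hle : ∫ x in ann N m, g x ≤ 0 := by
      refine ge_of_tendsto hlim ?_
      filter_upwards [Filter.eventually_gt_atTop 0, Filter.eventually_ge_atTop m] with k hk hkm
      have hk' : (0:ℝ) < k := by exact_mod_cast hk
      refine le_trans ?_ (main k hk')
      have hcu : Continuous (testU (N := N) γ φ k) := (testU_contDiff hk' hφ h0).continuous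
      have hcu' : Continuous (fun x => ‖testU (N := N) γ φ k x‖ ^ p) :=
        hcu.norm.rpow_const fun _ => Or.inr hp0.le
      have hint : Integrable (fun x => W x * ‖testU (N := N) γ φ k x‖ ^ p) := by
        rw [← integrableOn_iff_integrable_of_support_subset (s := ann N (2 * k))]
        · exact IntegrableOn.mul_continuousOn
            (hWloc.integrableOn_compact_subset (ann_ne _ _) (ann_compact N _)) hcu'.continuousOn
            (ann_compact N _)
        · intro x hx
          apply testU_support (γ := γ) hk' h0
          intro h
          apply hx
          simp [h, zero_rpow hp0.ne']
      calc ∫ x in ann N m, g x = ∫ x in ann N m, W x * ‖testU (N := N) γ φ k x‖ ^ p := by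
            refine setIntegral_congr_fun (ann_closed N m).measurableSet ?_
            intro x hx
            have hx0 : x ≠ 0 := ann_ne _ _ hx
            have hr : 0 < ‖x‖ := norm_pos_iff.2 hx0
            have : φ (log ‖x‖ / k) = 1 := by
              apply h1
              rw [abs_div, abs_of_pos hk', div_le_one hk']
              exact ((mem_ann hx0).1 hx).trans (by exact_mod_cast hkm)
            simp only [hg, testU, if_neg hx0, this, mul_one]
            rw [Complex.norm_real, norm_eq_abs, abs_of_pos (rpow_pos_of_pos hr _)]
        _ ≤ _ := by
            refine setIntegral_le_integral hint ?_
            filter_upwards [hWpos] with x hx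
            simp only [Pi.zero_apply]
            positivity
    have hg0' : 0 ≤ᵐ[volume.restrict (ann N m)] g := ae_restrict_of_ae hg0
    have hz := (setIntegral_eq_zero_iff_of_nonneg_ae hg0' hgi).1
      (le_antisymm hle (integral_nonneg_of_ae hg0'))
    rw [Filter.EventuallyEq, ae_restrict_iff' (ann_closed N m).measurableSet] at hz
    filter_upwards [hz] with x hx hxm
    have h := hx hxm
    have hr : 0 < ‖x‖ := norm_pos_iff.2 (ann_ne _ _ hxm)
    simp only [hg, Pi.zero_apply, mul_eq_zero] at h
    exact h.resolve_right (by positivity)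
  filter_upwards [ae_all_iff.2 hann, hae] with x hx hx0
  obtain ⟨m, hm⟩ := exists_nat_ge |log ‖x‖|
  exact hx m ((mem_ann hx0).2 hm)
end
end

section
/- Let N ≥ 1 and let p ≥ 2 be a real number. There exists a constant c with 2^{−p} ≤ c ≤ p·2^{−p} such that, setting W(x) = |(N − p)/p|^p |x|^{−p} + c(p−1)(1 − |x|)/|x| (note that W(x) > |(N−p)/p|^p |x|^{−p} on the set {0 < |x| < 1}, which has positive Lebesgue measure), one has for every u ∈ C^∞_c(ℝ^N \ {0};ℂ): ∫_{ℝ^N} |∇u(x)·(x/|x|)|^p dx ≥ ∫_{ℝ^N} W(x) |u(x)|^p dx, i.e. ∫_{ℝ^N} |∇u·(x/|x|)|^p dx − |(N − p)/p|^p ∫_{ℝ^N} |u|^p |x|^{−p} dx ≥ c(p−1) ∫_{ℝ^N} ((1 − |x|)/|x|) |u|^p dx. -/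
open MeasureTheory Real

noncomputable section

/-- Tangent-plane inequality for `‖·‖^p`. -/
lemma hardyAux_tangent {p : ℝ} (hp : 2 ≤ p) (a h : ℂ) :
    ‖a‖ ^ p + p * ‖a‖ ^ (p - 2) * inner ℝ a h ≤ ‖a + h‖ ^ p := by
  rcases eq_or_ne a 0 with rfl | ha
  · have : (0:ℝ) ^ p = 0 := Real.zero_rpow (by linarith)
    simp only [norm_zero, this, inner_zero_left, zero_add, mul_zero]
    positivity
  have ht : 0 < ‖a‖ := norm_pos_iff.mpr ha
  have hin : inner ℝ a h ≤ ‖a‖ * ‖a + h‖ - ‖a‖ ^ 2 := by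
    have h1 : inner ℝ a (a + h) ≤ ‖a‖ * ‖a + h‖ := real_inner_le_norm a (a + h)
    rw [inner_add_right, real_inner_self_eq_norm_sq] at h1
    linarith
  set t := ‖a‖
  set y := ‖a + h‖ with hy
  have hy0 : 0 ≤ y := norm_nonneg _
  have hB := one_add_mul_self_le_rpow_one_add (s := y / t - 1)
    (by have : 0 ≤ y / t := by positivity
        linarith) (p := p) (by linarith)
  have e1 : 1 + (y / t - 1) = y / t := by ring
  rw [e1, Real.div_rpow hy0 ht.le, le_div_iff₀ (by positivity)] at hB
  have e2 : t ^ p = t ^ (p - 2) * t ^ 2 := by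
    rw [← Real.rpow_natCast t 2, ← Real.rpow_add ht]; norm_num
  have h0 : 0 ≤ p * t ^ (p - 2) := by positivity
  have h3 := mul_le_mul_of_nonneg_left hin h0
  have e3 : (1 + p * (y / t - 1)) * t ^ p
      = t ^ p + p * t ^ (p - 2) * (t * y - t ^ 2) := by
    rw [e2]; field_simp
  linarith

/-- Clarkson's inequality. -/
lemma hardyAux_clarkson {p : ℝ} (hp : 2 ≤ p) (x y : ℂ) :
    ‖x + y‖ ^ p + ‖x - y‖ ^ p ≤ 2 ^ (p - 1) * (‖x‖ ^ p + ‖y‖ ^ p) := by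
  have key : ∀ t : ℝ, 0 ≤ t → t ^ p = (t ^ 2) ^ (p / 2) := by
    intro t ht
    rw [← Real.rpow_natCast t 2, ← Real.rpow_mul ht]; congr 1; push_cast; ring
  have h1 := Real.add_rpow_le_rpow_add (p := p / 2) (sq_nonneg ‖x + y‖) (sq_nonneg ‖x - y‖)
    (by linarith)
  have hpar : ‖x + y‖ ^ 2 + ‖x - y‖ ^ 2 = 2 * (‖x‖ ^ 2 + ‖y‖ ^ 2) := by
    have := parallelogram_law_with_norm ℝ x y
    nlinarith
  have h2 : (‖x‖ ^ 2 + ‖y‖ ^ 2) ^ (p / 2)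
      ≤ 2 ^ (p / 2 - 1) * ((‖x‖ ^ 2) ^ (p / 2) + (‖y‖ ^ 2) ^ (p / 2)) := by
    have := NNReal.rpow_add_le_mul_rpow_add_rpow (‖x‖₊ ^ 2) (‖y‖₊ ^ 2) (p := p / 2)
      (by linarith)
    exact_mod_cast this
  rw [key _ (norm_nonneg (x + y)), key _ (norm_nonneg (x - y)), key _ (norm_nonneg x),
    key _ (norm_nonneg y)]
  refine h1.trans ?_
  rw [hpar, Real.mul_rpow (by norm_num) (by positivity)]
  refine (mul_le_mul_of_nonneg_left h2 (by positivity)).trans (le_of_eq ?_)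
  rw [← mul_assoc, ← Real.rpow_add (by norm_num)]
  congr 2; ring

lemma hardyAux_strong {p : ℝ} (hp : 2 ≤ p) (a b : ℂ) :
    ‖a‖ ^ p + p * ‖a‖ ^ (p - 2) * inner ℝ a b + 2 * 2 ^ (-p) * ‖b‖ ^ p ≤ ‖a + b‖ ^ p := by
  have h1 := hardyAux_tangent hp a ((1 / 2 : ℝ) • b)
  have h2 := hardyAux_clarkson hp (a + (1 / 2 : ℝ) • b) ((1 / 2 : ℝ) • b)
  have h3 := hardyAux_clarkson hp (a + b) a
  rw [inner_smul_right] at h1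
  have e1 : a + b + a = (2 : ℝ) • (a + (1 / 2 : ℝ) • b) := by
    rw [smul_add, smul_smul]; norm_num [two_smul]; ring
  have e2 : a + b - a = b := by ring
  rw [e1, e2, norm_smul, Real.mul_rpow (norm_nonneg _) (norm_nonneg _)] at h3
  have e3 : (2 : ℝ) ^ p = 2 * 2 ^ (p - 1) := by
    rw [Real.rpow_sub_one (by norm_num)]; ring
  have e4 : (2 : ℝ) ^ (-p) = ((2 : ℝ) ^ p)⁻¹ := Real.rpow_neg (by norm_num) p
  have hpos : (0:ℝ) < 2 ^ (p - 1) := by positivity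
  simp only [Real.norm_ofNat] at h3
  rw [e3] at h3
  rw [e4, e3]
  set M := (2:ℝ) ^ (p - 1)
  have h4 : 2 * ‖a + (1 / 2 : ℝ) • b‖ ^ p + M⁻¹ * ‖b‖ ^ p ≤ ‖a + b‖ ^ p + ‖a‖ ^ p := by
    rw [← mul_le_mul_iff_right₀ hpos]
    refine le_trans (le_of_eq ?_) h3
    field_simp
  have e5 : 2 * (2 * M)⁻¹ = M⁻¹ := by field_simp
  rw [e5]
  linarith

lemma hardyAux_pointwise {p : ℝ} (hp : 2 ≤ p) (n r : ℝ) (hr : 0 < r) (u D : ℂ) :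
    (|(n - p) / p| ^ p * r ^ (-p) + 2 * 2 ^ (-p) * (p - 1) * (1 - r) / r) * ‖u‖ ^ p
      - |(n - p) / p| ^ (p - 2) * ((n - p) / p) *
        (r ^ (-p) * (r * (p * ‖u‖ ^ (p - 2) * inner ℝ u D)) + (n - p) * (r ^ (-p) * ‖u‖ ^ p))
      - 2 * 2 ^ (-p) * (p * ‖u‖ ^ (p - 2) * inner ℝ u D + (n - 1) * (‖u‖ ^ p / r))
      ≤ ‖D‖ ^ p := by
  set γ := (n - p) / p with hγ
  have hn : n = p * γ + p := by rw [hγ]; field_simp; ring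
  have hpow : ∀ t : ℝ, 0 ≤ t → t ^ (p - 2) * t ^ 2 = t ^ p := by
    intro t ht
    rw [← Real.rpow_natCast t 2, ← Real.rpow_add_of_nonneg ht (by linarith) (by norm_num)]
    norm_num
  have hs := hardyAux_strong hp (-(γ / r) • u) (D + (γ / r) • u)
  have ht := hardyAux_tangent hp (-u) (D + (γ / r) • u + u)
  have e1 : -(γ / r) • u + (D + (γ / r) • u) = D := by
    rw [neg_smul]; ring
  have e2 : -u + (D + (γ / r) • u + u) = D + (γ / r) • u := by ring
  rw [e2] at ht
  have hna : ‖-(γ / r) • u‖ = |γ| * r⁻¹ * ‖u‖ := by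
    rw [norm_smul, norm_neg, Real.norm_eq_abs, abs_div, abs_of_pos hr]; rfl
  rw [e1, hna, inner_smul_left, inner_add_right, inner_smul_right, real_inner_self_eq_norm_sq,
    Real.mul_rpow (by positivity) (by positivity), Real.mul_rpow (by positivity) (by positivity),
    Real.mul_rpow (by positivity) (by positivity), Real.mul_rpow (by positivity) (by positivity)]
    at hs
  simp only [norm_neg, inner_neg_left, inner_add_right, inner_smul_right,
    real_inner_self_eq_norm_sq] at ht
  have hu := hpow ‖u‖ (norm_nonneg _)
  have hrp : r⁻¹ ^ p = r ^ (-p) := by rw [Real.inv_rpow hr.le, Real.rpow_neg hr.le]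
  have hrp2 : r⁻¹ ^ (p - 2) = r ^ (-p) * r ^ 2 := by
    rw [← hrp, ← hpow r⁻¹ (by positivity)]; field_simp
  rw [hrp, hrp2] at hs
  have hc : (0:ℝ) ≤ 2 * 2 ^ (-p) := by positivity
  have ht' := mul_le_mul_of_nonneg_left ht hc
  refine le_trans ?_ hs
  refine le_trans (le_of_eq ?_) (add_le_add_right ht' _)
  simp only [conj_trivial]
  rw [← hu, hn]
  field_simp
  ring

/-- Integrability of functions continuous off the origin and vanishing off a compact set
avoiding the origin. -/
lemma hardyAux_cont {N : ℕ} {F : Type*} [NormedAddCommGroup F]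
    {K : Set (EuclideanSpace ℝ (Fin N))}
    (hK : IsCompact K) (hK0 : K ⊆ {x | x ≠ 0}) {g : EuclideanSpace ℝ (Fin N) → F}
    (hg : ∀ x, x ≠ 0 → ContinuousAt g x) (h0 : ∀ x, x ∉ K → g x = 0) :
    Continuous g ∧ HasCompactSupport g := by
  refine ⟨continuous_iff_continuousAt.mpr fun x => ?_, HasCompactSupport.intro hK h0⟩
  by_cases hx : x ∈ K
  · exact hg x (hK0 hx)
  · have : g =ᶠ[nhds x] fun _ => 0 := by
      filter_upwards [hK.isClosed.isOpen_compl.mem_nhds hx] with y hy using h0 y hy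
    exact (continuousAt_const).congr this.symm

/-- Divergence theorem for the radial field. -/
lemma hardyAux_div {N : ℕ} {k : EuclideanSpace ℝ (Fin N) → ℝ} (hk : ContDiff ℝ 1 k)
    (hc : HasCompactSupport k) :
    Integrable (fun x => fderiv ℝ k x x + N * k x) ∧
    ∫ x, (fderiv ℝ k x x + N * k x) = 0 := by
  have hkc : Continuous k := hk.continuous
  have hki : Integrable k := hkc.integrable_of_hasCompactSupport hc
  have hdk : Continuous (fderiv ℝ k) := hk.continuous_fderiv (by norm_num)
  have hdc : HasCompactSupport (fderiv ℝ k) := hc.fderiv (𝕜 := ℝ)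
  have hone : ∀ i : Fin N,
      Integrable (fun x : EuclideanSpace ℝ (Fin N) =>
        x i * fderiv ℝ k x (EuclideanSpace.single i 1)) ∧
      ∫ x : EuclideanSpace ℝ (Fin N), x i * fderiv ℝ k x (EuclideanSpace.single i 1)
        = - ∫ x, k x := by
    intro i
    have hfd : ∀ x : EuclideanSpace ℝ (Fin N),
        fderiv ℝ (fun x : EuclideanSpace ℝ (Fin N) => x i) x (EuclideanSpace.single i 1) = 1 := by
      intro x
      have : HasFDerivAt (fun x : EuclideanSpace ℝ (Fin N) => x i)
        (EuclideanSpace.proj i : EuclideanSpace ℝ (Fin N) →L[ℝ] ℝ) x :=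
        (EuclideanSpace.proj i : EuclideanSpace ℝ (Fin N) →L[ℝ] ℝ).hasFDerivAt
      rw [this.fderiv]; simp
    have hci : Continuous (fun x : EuclideanSpace ℝ (Fin N) => x i) := by fun_prop
    have hint : Integrable (fun x : EuclideanSpace ℝ (Fin N) =>
        x i * fderiv ℝ k x (EuclideanSpace.single i 1)) := by
      refine Continuous.integrable_of_hasCompactSupport (by fun_prop) ?_
      refine HasCompactSupport.intro hdc.isCompact fun x hx => ?_
      rw [image_eq_zero_of_notMem_tsupport hx]; simp
    refine ⟨hint, ?_⟩
    rw [integral_mul_fderiv_eq_neg_fderiv_mul_of_integrable]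
    · simp only [hfd, one_mul]
    · simpa only [hfd, one_mul] using hki
    · exact hint
    · refine Continuous.integrable_of_hasCompactSupport (by fun_prop) ?_
      exact hc.mul_left
    · intro x _
      fun_prop
    · intro x _
      exact (hk.differentiable (by norm_num)) x
  have hsum : (fun x => fderiv ℝ k x x + N * k x) = fun x : EuclideanSpace ℝ (Fin N) =>
      (∑ i, x i * fderiv ℝ k x (EuclideanSpace.single i 1)) + N * k x := by
    funext x
    congr 1
    have hlin : ∀ l : EuclideanSpace ℝ (Fin N) →L[ℝ] ℝ,
        l x = ∑ i, x i * l (EuclideanSpace.single i 1) := by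
      intro l
      conv_lhs => rw [← (EuclideanSpace.basisFun (Fin N) ℝ).sum_repr x, map_sum]
      simp
    exact hlin _
  rw [hsum]
  have hI : Integrable (fun x : EuclideanSpace ℝ (Fin N) =>
      (∑ i, x i * fderiv ℝ k x (EuclideanSpace.single i 1))) :=
    integrable_finsetSum _ fun i _ => (hone i).1
  refine ⟨hI.add (hki.const_mul _), ?_⟩
  rw [integral_add hI (hki.const_mul _), integral_finsetSum _ fun i _ => (hone i).1,
    integral_const_mul]
  simp [(hone _).2]

lemma hardyAux_weight {N : ℕ} {p : ℝ} (hp : 2 ≤ p) (s : ℝ)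
    {u : EuclideanSpace ℝ (Fin N) → ℂ} (hu : ContDiff ℝ 1 u) (hc : HasCompactSupport u)
    (h0 : tsupport u ⊆ {x | x ≠ 0}) :
    ContDiff ℝ 1 (fun x => ‖x‖ ^ s * ‖u x‖ ^ p) ∧
    HasCompactSupport (fun x => ‖x‖ ^ s * ‖u x‖ ^ p) ∧
    ∀ x, x ≠ 0 → fderiv ℝ (fun x => ‖x‖ ^ s * ‖u x‖ ^ p) x x =
      s * (‖x‖ ^ s * ‖u x‖ ^ p)
        + ‖x‖ ^ s * (p * ‖u x‖ ^ (p - 2) * inner ℝ (u x) (fderiv ℝ u x x)) := by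
  have hf : ContDiff ℝ 1 (fun x => ‖u x‖ ^ p) := hu.norm_rpow (by linarith)
  have hz : ∀ x, x ∉ tsupport u → ‖x‖ ^ s * ‖u x‖ ^ p = 0 := by
    intro x hx
    rw [image_eq_zero_of_notMem_tsupport hx, norm_zero, Real.zero_rpow (by linarith), mul_zero]
  refine ⟨?_, HasCompactSupport.intro hc.isCompact hz, ?_⟩
  · rw [contDiff_iff_contDiffAt]
    intro x
    by_cases hx : x ∈ tsupport u
    · have hx0 : x ≠ 0 := h0 hx
      exact ((contDiffAt_norm ℝ hx0).rpow_const_of_ne (norm_ne_zero_iff.mpr hx0)).mul hf.contDiffAt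
    · have : (fun x => ‖x‖ ^ s * ‖u x‖ ^ p) =ᶠ[nhds x] fun _ => (0:ℝ) := by
        filter_upwards [(isClosed_tsupport u).isOpen_compl.mem_nhds hx] with y hy using hz y hy
      exact contDiffAt_const.congr_of_eventuallyEq this
  · intro x hx
    have hxn : ‖x‖ ≠ 0 := norm_ne_zero_iff.mpr hx
    have hnd : DifferentiableAt ℝ (fun y : EuclideanSpace ℝ (Fin N) => ‖y‖) x :=
      (contDiffAt_norm ℝ hx (n := 1)).differentiableAt (by norm_num)
    have h1 := (hnd.hasFDerivAt.rpow_const (p := s) (Or.inl hxn)).mul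
      (hf.differentiable (by norm_num) x).hasFDerivAt
    have h2 : fderiv ℝ (fun y : EuclideanSpace ℝ (Fin N) => ‖y‖) x x = ‖x‖ :=
      hnd.fderiv_norm_self
    have h3 := (hu.differentiable (by norm_num)).fderiv_norm_rpow (x := x) (p := p) (by linarith)
    have h5 : fderiv ℝ (fun x => ‖x‖ ^ s * ‖u x‖ ^ p) x = _ := HasFDerivAt.fderiv h1
    rw [h5, h3]
    have h4 : ‖x‖ ^ s = ‖x‖ ^ (s - 1) * ‖x‖ := by
      rw [Real.rpow_sub_one hxn]; field_simp
    simp [h2]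
    rw [h4]
    ring

/-- **An improved Hardy inequality with a potential positive on a set of positive
measure**: there is `c ∈ [2^{-p}, p 2^{-p}]` such that, with
`W(x) = |(N-p)/p|^p |x|^{-p} + c(p-1)(1-|x|)/|x|` (which is strictly larger than
`|(N-p)/p|^p |x|^{-p}` on `{0 < |x| < 1}`), one has
`∫ |∇u·(x/|x|)|^p ≥ ∫ W |u|^p` for all `u ∈ C^∞_c(ℝ^N \ {0};ℂ)`. -/
theorem hardy_with_positive_potential
    {N : ℕ} (hN : 1 ≤ N)
    {p : ℝ} (hp : 2 ≤ p) :
    ∃ c : ℝ, (2 : ℝ) ^ (-p) ≤ c ∧ c ≤ p * (2 : ℝ) ^ (-p) ∧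
      (∀ x : EuclideanSpace ℝ (Fin N), x ≠ 0 → ‖x‖ < 1 →
        |((N : ℝ) - p) / p| ^ p * ‖x‖ ^ (-p)
          < |((N : ℝ) - p) / p| ^ p * ‖x‖ ^ (-p) + c * (p - 1) * (1 - ‖x‖) / ‖x‖) ∧
      ∀ u : EuclideanSpace ℝ (Fin N) → ℂ,
        ContDiff ℝ (⊤ : ℕ∞) u → HasCompactSupport u →
        tsupport u ⊆ {x : EuclideanSpace ℝ (Fin N) | x ≠ 0} →
        ∫ x, (|((N : ℝ) - p) / p| ^ p * ‖x‖ ^ (-p)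
              + c * (p - 1) * (1 - ‖x‖) / ‖x‖) * ‖u x‖ ^ p
          ≤ ∫ x, ‖fderiv ℝ u x (‖x‖⁻¹ • x)‖ ^ p := by
  have hP : (0:ℝ) < 2 ^ (-p) := by positivity
  refine ⟨2 * 2 ^ (-p), by linarith, by nlinarith, ?_, ?_⟩
  · intro x hx hx1
    have hxn : 0 < ‖x‖ := norm_pos_iff.mpr hx
    have h1 : 0 < p - 1 := by linarith
    have h2 : 0 < 1 - ‖x‖ := by linarith
    have : 0 < 2 * 2 ^ (-p) * (p - 1) * (1 - ‖x‖) / ‖x‖ := by positivity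
    linarith
  intro u hu' hc h0
  have hu : ContDiff ℝ 1 u := hu'.of_le (by exact_mod_cast le_top)
  obtain ⟨k1, k1c, k1d⟩ := hardyAux_weight hp (-p) hu hc h0
  obtain ⟨k2, k2c, k2d⟩ := hardyAux_weight hp (-1) hu hc h0
  obtain ⟨i1, z1⟩ := hardyAux_div k1 k1c
  obtain ⟨i2, z2⟩ := hardyAux_div k2 k2c
  have hdu : Continuous (fderiv ℝ u) := hu.continuous_fderiv (by norm_num)
  have hf : Continuous (fun x => ‖u x‖ ^ p) :=
    (hu.norm_rpow (p := p) (by linarith)).continuous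
  have hW : Integrable (fun x => (|((N : ℝ) - p) / p| ^ p * ‖x‖ ^ (-p)
              + 2 * 2 ^ (-p) * (p - 1) * (1 - ‖x‖) / ‖x‖) * ‖u x‖ ^ p) := by
    have := hardyAux_cont hc.isCompact h0 (g := fun x => (|((N : ℝ) - p) / p| ^ p * ‖x‖ ^ (-p)
              + 2 * 2 ^ (-p) * (p - 1) * (1 - ‖x‖) / ‖x‖) * ‖u x‖ ^ p) ?_ ?_
    · exact this.1.integrable_of_hasCompactSupport this.2
    · intro x hx
      have hxn : ‖x‖ ≠ 0 := norm_ne_zero_iff.mpr hx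
      refine ContinuousAt.mul (ContinuousAt.add (continuousAt_const.mul
        (continuous_norm.continuousAt.rpow_const (Or.inl hxn)))
        (ContinuousAt.div (by fun_prop) (by fun_prop) hxn)) hf.continuousAt
    · intro x hx
      rw [image_eq_zero_of_notMem_tsupport hx, norm_zero, Real.zero_rpow (by linarith), mul_zero]
  have hD : Integrable (fun x => ‖fderiv ℝ u x (‖x‖⁻¹ • x)‖ ^ p) := by
    have := hardyAux_cont hc.isCompact h0 (g := fun x => ‖fderiv ℝ u x (‖x‖⁻¹ • x)‖ ^ p) ?_ ?_
    · exact this.1.integrable_of_hasCompactSupport this.2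
    · intro x hx
      have hxn : ‖x‖ ≠ 0 := norm_ne_zero_iff.mpr hx
      refine ContinuousAt.rpow_const ?_ (Or.inr (by linarith))
      refine ContinuousAt.norm (ContinuousAt.clm_apply hdu.continuousAt ?_)
      exact (continuous_norm.continuousAt.inv₀ hxn).smul continuousAt_id
    · intro x hx
      have : fderiv ℝ u x = 0 := by
        by_contra hne
        exact hx (support_fderiv_subset ℝ (f := u) hne)
      simp only [this]
      simp [Real.zero_rpow (show p ≠ 0 by linarith)]
  set C := |((N : ℝ) - p) / p| ^ (p - 2) * (((N : ℝ) - p) / p) with hC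
  have hL := (hW.sub (i1.const_mul C)).sub (i2.const_mul (2 * 2 ^ (-p)))
  have hWI : ∫ x, (|((N : ℝ) - p) / p| ^ p * ‖x‖ ^ (-p)
              + 2 * 2 ^ (-p) * (p - 1) * (1 - ‖x‖) / ‖x‖) * ‖u x‖ ^ p
      = ∫ x, (((|((N : ℝ) - p) / p| ^ p * ‖x‖ ^ (-p)
              + 2 * 2 ^ (-p) * (p - 1) * (1 - ‖x‖) / ‖x‖) * ‖u x‖ ^ p
        - C * (fderiv ℝ (fun x => ‖x‖ ^ (-p) * ‖u x‖ ^ p) x x + N * (‖x‖ ^ (-p) * ‖u x‖ ^ p)))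
        - 2 * 2 ^ (-p) * (fderiv ℝ (fun x => ‖x‖ ^ (-1:ℝ) * ‖u x‖ ^ p) x x
          + N * (‖x‖ ^ (-1:ℝ) * ‖u x‖ ^ p))) := by
    refine Eq.trans ?_
      (integral_sub (hW.sub (i1.const_mul C)) (i2.const_mul (2 * 2 ^ (-p)))).symm
    rw [integral_sub' hW (i1.const_mul C), integral_const_mul, integral_const_mul, z1, z2]
    ring
  rw [hWI]
  refine integral_mono hL hD fun x => ?_
  beta_reduce
  by_cases hx : x = 0
  · have hx' : x ∉ tsupport u := fun h => h0 h hx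
    have hu0 : u x = 0 := image_eq_zero_of_notMem_tsupport hx'
    have hz : (0:ℝ) ^ p = 0 := Real.zero_rpow (by linarith)
    subst hx
    rw [hu0, norm_zero]
    simp [hz]
  · have hxn : 0 < ‖x‖ := norm_pos_iff.mpr hx
    have hpt := hardyAux_pointwise hp N ‖x‖ hxn (u x) (fderiv ℝ u x (‖x‖⁻¹ • x))
    refine le_trans (le_of_eq ?_) hpt
    rw [k1d x hx, k2d x hx, map_smul, inner_smul_right, ← hC, Real.rpow_neg_one]
    field_simp
    ring
end
end
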